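/- arXiv:2008.04519 — 11 statements merged into one kernel-verified Lean document; each statement's English description precedes it below -/
import Mathlib

section
/- With the setup below, the following identities hold in R: (i) F_{ij} = D_{ij}^i for all i ≠ j; (ii) F_{ii} = 0 for all i; (iii) I_{ij} = E_{ij} for all i ≠ j; (iv) I_{ii} = G_i for all i; (v) K_i = J_i for all i. -/
theorem LinearMap.map_affine_comb_mul {R A ι : Type*} [CommRing R] [CommRing A] [Algebra R A]
    [Fintype ι] (f : A →ₗ[R] R) (c : ι → R) (e : R) (y : ι → A) (z : A) :
    f (((∑ k, algebraMap R A (c k) * y k) + algebraMap R A e) * z) =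
      (∑ k, c k * f (y k * z)) + e * f z := by
  simp only [add_mul, Finset.sum_mul, map_add, map_sum, ← Algebra.smul_def, smul_mul_assoc,
    map_smul, smul_eq_mul]

/-- Proposition (identities among the structure constants): `F_{ij} = D_{ij}^i` for `i ≠ j`,
`F_{ii} = 0`, `I_{ij} = E_{ij}` for `i ≠ j`, `I_{ii} = G_i`, and `K_i = J_i`. -/
theorem stmt_1 (R A : Type*) [CommRing R] [CommRing A] [Algebra R A]
    (n : ℕ) (hn : 1 ≤ n)
    (x : Fin n → A) (ν : A)
    (D : Fin n → Fin n → Fin n → R) (E : Fin n → Fin n → R)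
    (F : Fin n → Fin n → R) (G : Fin n → R) (I : Fin n → Fin n → R)
    (J : Fin n → R) (K : Fin n → R) (ω : R)
    (hxx : ∀ i j, i ≠ j → x i * x j =
      (∑ k, algebraMap R A (D i j k) * x k) + algebraMap R A (E i j))
    (hxsq : ∀ i, x i ^ 2 =
      ν + (∑ j, algebraMap R A (F i j) * x j) + algebraMap R A (G i))
    (hxnu : ∀ i, x i * ν =
      (∑ j, algebraMap R A (I i j) * x j) + algebraMap R A (J i))
    (hnunu : ν ^ 2 = (∑ j, algebraMap R A (K j) * x j) + algebraMap R A ω)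
    (int : A →ₗ[R] R)
    (h1 : int 1 = 0)
    (hx : ∀ j, int (x j) = 0)
    (hx2 : ∀ j, int (x j ^ 2) = 1)
    (hxij : ∀ i j, i ≠ j → int (x i * x j) = 0)
    (hx3 : ∀ j, int (x j ^ 3) = 0)
    (hnu : int ν = 1)
    (hxnu' : ∀ j, int (x j * ν) = 0)
    (hnu2 : int (ν ^ 2) = 0) :
    (∀ i j, i ≠ j → F i j = D i j i) ∧
    (∀ i, F i i = 0) ∧
    (∀ i j, i ≠ j → I i j = E i j) ∧
    (∀ i, I i i = G i) ∧
    (∀ i, K i = J i) := by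
  have pairing (c : Fin n → R) (i : Fin n) : ∑ k, c k * int (x k * x i) = c i := by
    rw [Finset.sum_eq_single i]
    · rw [← sq, hx2, mul_one]
    · intro k _ hk
      rw [hxij k i hk, mul_zero]
    · simp
  have comb_mul_x (c : Fin n → R) (e : R) (i : Fin n) :
      int (((∑ k, algebraMap R A (c k) * x k) + algebraMap R A e) * x i) = c i := by
    rw [int.map_affine_comb_mul, pairing, hx, mul_zero, add_zero]
  have comb_mul_nu (c : Fin n → R) (e : R) :
      int (((∑ k, algebraMap R A (c k) * x k) + algebraMap R A e) * ν) = e := by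
    simp [int.map_affine_comb_mul, hxnu', hnu]
  have sq_mul_x (i j : Fin n) : int (x i ^ 2 * x j) = F i j := by
    rw [hxsq, add_assoc, add_mul, map_add, comb_mul_x, mul_comm, hxnu', zero_add]
  have sq_mul_nu (i : Fin n) : int (x i ^ 2 * ν) = G i := by
    rw [hxsq, add_assoc, add_mul, map_add, comb_mul_nu, ← sq, hnu2, zero_add]
  refine ⟨fun i j hij => ?_, fun i => ?_, fun i j hij => ?_, fun i => ?_, fun i => ?_⟩
  · rw [← sq_mul_x, ← comb_mul_x (D i j) (E i j) i, ← hxx i j hij]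
    congr 1
    ring
  · rw [← sq_mul_x, ← pow_succ, hx3]
  · rw [← comb_mul_x (I i) (J i) j, ← hxnu, ← comb_mul_nu (D i j) (E i j), ← hxx i j hij]
    congr 1
    ring
  · rw [← sq_mul_nu, ← comb_mul_x (I i) (J i) i, ← hxnu]
    congr 1
    ring
  · rw [← comb_mul_x K ω i, ← hnunu, ← comb_mul_nu (I i) (J i), ← hxnu]
    congr 1
    ring
end

section
/- With the setup below, for all i ≠ j one has D_{ji}³ = B_i·D_{ji} + C_i in R. That is, D_{ji} satisfies the same cubic equation t³ = B_i·t + C_i as x_i. -/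
/-- `D_{ji}` satisfies the same cubic equation `t³ = B_i·t + C_i` as `x_i`. -/
theorem stmt_4 (R A : Type*) [CommRing R] [CommRing A] [Algebra R A]
    (n : ℕ) (hn : 1 ≤ n)
    (x : Fin n → A) (ν : A)
    (D : Fin n → Fin n → R) (G J : Fin n → R)
    (hxx : ∀ i j, i ≠ j → x i * x j =
      algebraMap R A (D i j) * x i + algebraMap R A (D j i) * x j
        - algebraMap R A (D i j * D j i))
    (hxsq : ∀ i, x i ^ 2 =
      ν + (∑ j ∈ Finset.univ.erase i, algebraMap R A (D i j) * x j)
        + algebraMap R A (G i))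
    (hxnu : ∀ i, x i * ν =
      algebraMap R A (G i) * x i
        - (∑ j ∈ Finset.univ.erase i, algebraMap R A (D i j * D j i) * x j)
        + algebraMap R A (J i))
    (B C : Fin n → R)
    (hB : ∀ i, B i = 2 * G i + ∑ j ∈ Finset.univ.erase i, D i j ^ 2)
    (hC : ∀ i, C i = J i - ∑ j ∈ Finset.univ.erase i, D i j ^ 2 * D j i)
    (int : A →ₗ[R] R)
    (h1 : int 1 = 0)
    (hx : ∀ j, int (x j) = 0)
    (hx2 : ∀ j, int (x j ^ 2) = 1) :
    ∀ i j, i ≠ j → D j i ^ 3 = B i * D j i + C i := by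
  intro i j hij
  have cubic : x i ^ 3 = algebraMap R A (B i) * x i + algebraMap R A (C i) := by
    have hsum : (∑ k ∈ Finset.univ.erase i, algebraMap R A (D i k) * x k) * x i =
        algebraMap R A (∑ k ∈ Finset.univ.erase i, D i k ^ 2) * x i
          + (∑ k ∈ Finset.univ.erase i, algebraMap R A (D i k * D k i) * x k)
          - algebraMap R A (∑ k ∈ Finset.univ.erase i, D i k ^ 2 * D k i) := by
      rw [map_sum, map_sum, Finset.sum_mul, Finset.sum_mul, ← Finset.sum_add_distrib,
        ← Finset.sum_sub_distrib]
      refine Finset.sum_congr rfl fun k hk => ?_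
      have hprod := hxx i k (Finset.ne_of_mem_erase hk).symm
      simp only [map_mul, map_pow] at hprod ⊢
      linear_combination algebraMap R A (D i k) * hprod
    rw [hB, hC]
    simp only [map_add, map_sub, map_mul, map_ofNat]
    simp only [map_mul] at hsum hxnu
    linear_combination x i * hxsq i + hxnu i + hsum
  have annihilated : (D j i ^ 3 - B i * D j i - C i) • (x j ^ 2 - D i j • x j) = 0 := by
    have hprod := hxx i j hij
    simp only [Algebra.smul_def, map_sub, map_mul, map_pow] at hprod ⊢
    linear_combination x j * (x j - algebraMap R A (D i j)) * cubic
      - x j * (x i ^ 2 + x i * algebraMap R A (D j i) + algebraMap R A (D j i) ^ 2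
        - algebraMap R A (B i)) * hprod
  have hint := congrArg int annihilated
  simp only [map_smul, map_sub, hx2, hx, map_zero, smul_eq_mul] at hint
  linear_combination hint
end

section
/- (Integration formula.) Let R be a commutative ring, A a commutative R-algebra, n ≥ 1, x_1,…,x_n ∈ A, and D_{ij} ∈ R for i ≠ j, such that (x_i − D_{ji})·(x_j − D_{ij}) = 0 in A for all i ≠ j, and (D_{ij} − D_{kj})·(D_{ik} − D_{jk}) = 0 in R for all pairwise distinct i, j, k (scalars in R are identified with their images in A). Let ∫ : A → R be an R-linear map with ∫(r·1) = 0 for every r ∈ R. Then for every multivariate polynomial f in n variables with coefficients in R, ∫(f(x_1,…,x_n)) = Σ_{j=1}^n ∫(f_j(x_j)), where f_j(x_j) denotes the evaluation of f at the point whose i-th coordinate is D_{ji} (viewed in A) for i ≠ j and is x_j for i = j. -/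
/-- If `c` kills `a - b`, then after multiplication by `c` it does not matter whether a coordinate
of an evaluation point is `a` or `b`. -/
lemma mul_aeval_update_congr {σ R A : Type*} [DecidableEq σ] [CommRing R] [CommRing A]
    [Algebra R A] (v : σ → A) (j : σ) {a b c : A} (h : c * (a - b) = 0) (f : MvPolynomial σ R) :
    c * MvPolynomial.aeval (Function.update v j a) f =
      c * MvPolynomial.aeval (Function.update v j b) f := by
  induction f using MvPolynomial.induction_on with
  | C r => simp
  | add p q hp hq => simp only [map_add, mul_add, hp, hq]
  | mul_X p m hp =>
    simp only [map_mul, MvPolynomial.aeval_X]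
    by_cases hm : m = j
    · subst hm
      simp only [Function.update_self]
      linear_combination a * hp + MvPolynomial.aeval (Function.update v m b) p * h
    · simp only [Function.update_of_ne hm]
      linear_combination v m * hp

/-- The sum over `j ≠ k` of the values of `f` at the points with coordinates `D j i` for `i ≠ j`
and `D k j` for `i = j`. -/
noncomputable def nodeSum {σ R : Type*} [Fintype σ] [DecidableEq σ] [CommRing R]
    (D : σ → σ → R) (k : σ) (f : MvPolynomial σ R) : R :=
  ∑ j ∈ Finset.univ.erase k, MvPolynomial.aeval (Function.update (D j) j (D k j)) f

section NodeSum

variable {σ R : Type*} [Fintype σ] [DecidableEq σ] [CommRing R] {D : σ → σ → R}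

lemma nodeSum_C (k : σ) (r : R) :
    nodeSum D k (MvPolynomial.C r) = (Fintype.card σ - 1 : ℕ) * r := by
  simp [nodeSum, Finset.card_erase_of_mem]

lemma nodeSum_add (k : σ) (f g : MvPolynomial σ R) :
    nodeSum D k (f + g) = nodeSum D k f + nodeSum D k g := by
  simp [nodeSum, Finset.sum_add_distrib]

lemma nodeSum_mul_X_self (m : σ) (f : MvPolynomial σ R) :
    nodeSum D m (f * MvPolynomial.X m) = ∑ j ∈ Finset.univ.erase m,
      MvPolynomial.aeval (Function.update (D j) j (D m j)) f * D j m := by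
  refine Finset.sum_congr rfl fun j hj => ?_
  rw [map_mul, MvPolynomial.aeval_X, Function.update_of_ne (Finset.ne_of_mem_erase hj).symm]

lemma nodeSum_mul_X_of_ne
    (hD : ∀ i j k, i ≠ j → i ≠ k → j ≠ k → (D i j - D k j) * (D i k - D j k) = 0)
    {k m : σ} (hkm : k ≠ m) (f : MvPolynomial σ R) :
    nodeSum D k (f * MvPolynomial.X m) =
      nodeSum D m (f * MvPolynomial.X m) + D k m * (nodeSum D k f - nodeSum D m f) := by
  have hsub : ∑ j ∈ Finset.univ.erase k,
        MvPolynomial.aeval (Function.update (D j) j (D k j)) f *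
          (Function.update (D j) j (D k j) m - D k m) =
      ∑ j ∈ Finset.univ.erase m,
        MvPolynomial.aeval (Function.update (D j) j (D m j)) f * (D j m - D k m) := by
    rw [← Finset.add_sum_erase _ _ (Finset.mem_erase.2 ⟨hkm.symm, Finset.mem_univ m⟩),
      ← Finset.add_sum_erase _ _ (Finset.mem_erase.2 ⟨hkm, Finset.mem_univ k⟩),
      Finset.erase_right_comm]
    simp only [Function.update_self, sub_self, mul_zero, zero_add]
    refine Finset.sum_congr rfl fun j hj => ?_
    simp only [Finset.mem_erase, Finset.mem_univ, and_true] at hj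
    rw [Function.update_of_ne hj.2.symm, mul_comm, mul_comm _ (D j m - D k m)]
    refine mul_aeval_update_congr _ _ ?_ f
    linear_combination hD k j m hj.1.symm hkm hj.2 * (-1)
  simp only [mul_sub, Finset.sum_sub_distrib, ← Finset.sum_mul] at hsub
  rw [nodeSum_mul_X_self]
  simp only [nodeSum, map_mul, MvPolynomial.aeval_X]
  linear_combination hsub

lemma nodeSum_eq_nodeSum
    (hD : ∀ i j k, i ≠ j → i ≠ k → j ≠ k → (D i j - D k j) * (D i k - D j k) = 0)
    (f : MvPolynomial σ R) (k l : σ) : nodeSum D k f = nodeSum D l f := by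
  induction f using MvPolynomial.induction_on generalizing k l with
  | C r => simp only [nodeSum_C]
  | add p q hp hq => rw [nodeSum_add, nodeSum_add, hp k l, hq k l]
  | mul_X p m hp =>
    have key : ∀ k, nodeSum D k (p * MvPolynomial.X m) = nodeSum D m (p * MvPolynomial.X m) := by
      intro k
      by_cases hkm : k = m
      · rw [hkm]
      · rw [nodeSum_mul_X_of_ne hD hkm, hp k m, sub_self, mul_zero, add_zero]
    rw [key k, key l]

lemma algebraMap_nodeSum {A : Type*} [CommRing A] [Algebra R A] (k : σ) (f : MvPolynomial σ R) :
    algebraMap R A (nodeSum D k f) = ∑ j ∈ Finset.univ.erase k, MvPolynomial.aeval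
      (Function.update (fun i => algebraMap R A (D j i)) j (algebraMap R A (D k j))) f := by
  rw [nodeSum, map_sum]
  refine Finset.sum_congr rfl fun j _ => ?_
  rw [← MvPolynomial.aeval_algebraMap_apply]
  congr 2
  exact Function.comp_update (algebraMap R A) (D j) j (D k j)

/-- Up to a scalar, `f (x)` is the sum of its restrictions to the components of the curve cut out
by the relations. -/
theorem aeval_add_algebraMap_nodeSum {A : Type*} [CommRing A] [Algebra R A] {x : σ → A}
    (hxx : ∀ i j, i ≠ j → (x i - algebraMap R A (D j i)) * (x j - algebraMap R A (D i j)) = 0)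
    (hD : ∀ i j k, i ≠ j → i ≠ k → j ≠ k → (D i j - D k j) * (D i k - D j k) = 0)
    (f : MvPolynomial σ R) (k : σ) :
    MvPolynomial.aeval x f + algebraMap R A (nodeSum D k f) = ∑ j, MvPolynomial.aeval
      (Function.update (fun i => algebraMap R A (D j i)) j (x j)) f := by
  induction f using MvPolynomial.induction_on generalizing k with
  | C r =>
    obtain ⟨c, hc⟩ := Nat.exists_eq_add_one.2 (Fintype.card_pos_iff.2 ⟨k⟩)
    simp only [nodeSum_C, MvPolynomial.aeval_C, Finset.sum_const, Finset.card_univ, nsmul_eq_mul,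
      map_mul, map_natCast, hc, Nat.add_sub_cancel]
    push_cast
    ring
  | add p q hp hq =>
    simp only [map_add, nodeSum_add, Finset.sum_add_distrib, ← hp k, ← hq k]
    ring
  | mul_X p m hp =>
    have hterm : ∑ j ∈ Finset.univ.erase m, MvPolynomial.aeval
          (Function.update (fun i => algebraMap R A (D j i)) j (x j)) p *
            (x m - algebraMap R A (D j m)) =
        ∑ j ∈ Finset.univ.erase m, MvPolynomial.aeval
          (Function.update (fun i => algebraMap R A (D j i)) j (algebraMap R A (D m j))) p *
            (x m - algebraMap R A (D j m)) := by
      refine Finset.sum_congr rfl fun j hj => ?_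
      rw [mul_comm, mul_comm _ (x m - _)]
      exact mul_aeval_update_congr _ _ (hxx m j (Finset.ne_of_mem_erase hj).symm) p
    have hrestrict : ∑ j ∈ Finset.univ.erase m, MvPolynomial.aeval
          (Function.update (fun i => algebraMap R A (D j i)) j (x j)) (p * MvPolynomial.X m) =
        ∑ j ∈ Finset.univ.erase m, MvPolynomial.aeval
          (Function.update (fun i => algebraMap R A (D j i)) j (x j)) p *
            algebraMap R A (D j m) := by
      refine Finset.sum_congr rfl fun j hj => ?_
      rw [map_mul, MvPolynomial.aeval_X, Function.update_of_ne (Finset.ne_of_mem_erase hj).symm]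
    have hnode : algebraMap R A (nodeSum D m (p * MvPolynomial.X m)) =
        ∑ j ∈ Finset.univ.erase m, MvPolynomial.aeval
          (Function.update (fun i => algebraMap R A (D j i)) j (algebraMap R A (D m j))) p *
            algebraMap R A (D j m) := by
      rw [algebraMap_nodeSum]
      refine Finset.sum_congr rfl fun j hj => ?_
      rw [map_mul, MvPolynomial.aeval_X, Function.update_of_ne (Finset.ne_of_mem_erase hj).symm]
    have hpm := hp m
    rw [algebraMap_nodeSum, ← Finset.add_sum_erase _ _ (Finset.mem_univ m)] at hpm
    simp only [mul_sub, Finset.sum_sub_distrib, ← Finset.sum_mul] at hterm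
    rw [nodeSum_eq_nodeSum hD _ k m, hnode, ← Finset.add_sum_erase _ _ (Finset.mem_univ m),
      hrestrict, map_mul, map_mul, MvPolynomial.aeval_X, MvPolynomial.aeval_X,
      Function.update_self]
    linear_combination x m * hpm + hterm

end NodeSum

/-- The integration formula:
`∫ f(x_1,…,x_n) = Σ_j ∫ f(D_{j1},…,D_{j(j-1)}, x_j, D_{j(j+1)},…,D_{jn})`. -/
theorem stmt_5 (R A : Type*) [CommRing R] [CommRing A] [Algebra R A]
    (n : ℕ) (hn : 1 ≤ n)
    (x : Fin n → A) (D : Fin n → Fin n → R)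
    (hxx : ∀ i j, i ≠ j →
      (x i - algebraMap R A (D j i)) * (x j - algebraMap R A (D i j)) = 0)
    (hD : ∀ i j k, i ≠ j → i ≠ k → j ≠ k →
      (D i j - D k j) * (D i k - D j k) = 0)
    (int : A →ₗ[R] R)
    (hscalar : ∀ r : R, int (algebraMap R A r) = 0)
    (f : MvPolynomial (Fin n) R) :
    int (MvPolynomial.aeval x f) =
      ∑ j, int (MvPolynomial.aeval
        (fun i => if i = j then x j else algebraMap R A (D j i)) f) := by
  have key := congrArg int (aeval_add_algebraMap_nodeSum hxx hD f ⟨0, hn⟩)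
  rw [map_add, hscalar, add_zero, map_sum] at key
  rw [key]
  refine Finset.sum_congr rfl fun j _ => ?_
  congr 3
  funext i
  by_cases hij : i = j
  · subst hij
    simp
  · simp [hij]
end

section
/- Let R be a commutative ring, A a commutative R-algebra, x ∈ A, and B, C, D ∈ R such that x³ = B·x + C in A and D³ = B·D + C in R (scalars in R are identified with their images in A). Let ∫ : A → R be an R-linear map with ∫(1) = 0, ∫(x) = 0, and ∫(x²) = 1. Then for every integer m ≥ 0, ∫(x^m·(x² + D·x + D² − B)) = D^m. -/
/-- If `x³ = B·x + C` in `A` and `D³ = B·D + C` in `R`, then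
`∫(x^m·(x² + D·x + D² − B)) = D^m` for all `m ≥ 0`. -/
theorem stmt_6 (R A : Type*) [CommRing R] [CommRing A] [Algebra R A]
    (x : A) (B C D : R)
    (hx : x ^ 3 = algebraMap R A B * x + algebraMap R A C)
    (hD : D ^ 3 = B * D + C)
    (int : A →ₗ[R] R)
    (h1 : int 1 = 0)
    (hx1 : int x = 0)
    (hx2 : int (x ^ 2) = 1) :
    ∀ m : ℕ, int (x ^ m * (x ^ 2 + algebraMap R A D * x
      + algebraMap R A (D ^ 2) - algebraMap R A B)) = D ^ m := by
  have hD' : algebraMap R A D ^ 3 = algebraMap R A B * algebraMap R A D + algebraMap R A C := by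
    rw [← map_pow, hD, map_add, map_mul]
  intro m
  induction m with
  | zero =>
    have h : x ^ 0 * (x ^ 2 + algebraMap R A D * x + algebraMap R A (D ^ 2) - algebraMap R A B)
        = x ^ 2 + D • x + (D ^ 2 - B) • (1 : A) := by
      simp only [Algebra.smul_def, map_sub, map_pow]
      ring
    rw [h]
    simp [h1, hx1, hx2]
  | succ m ih =>
    have h : x ^ (m + 1) * (x ^ 2 + algebraMap R A D * x + algebraMap R A (D ^ 2)
        - algebraMap R A B) = D • (x ^ m * (x ^ 2 + algebraMap R A D * x
        + algebraMap R A (D ^ 2) - algebraMap R A B)) := by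
      simp only [Algebra.smul_def, map_pow]
      linear_combination x ^ m * hx - x ^ m * hD'
    rw [h, map_smul, ih, smul_eq_mul, pow_succ']
end

section
/- (Second integration formula.) With the setup below, set e = 2·ν + x_1² + ⋯ + x_n² ∈ A. Then for each fixed index i and every multivariate polynomial f in n variables with coefficients in R: ∫(f(x_1,…,x_n)·e) = Σ_{j=1}^n ∫(f_j(x_j)·(3·x_j² − B_j)) − 2·Σ_{j ≠ i} f_j(D_{ij}), where f_j(x_j) denotes the evaluation of f at the point whose k-th coordinate is D_{jk} for k ≠ j and is x_j for k = j, and f_j(D_{ij}) ∈ R denotes the evaluation of f at the point whose k-th coordinate is D_{jk} for k ≠ j and is D_{ij} for k = j. -/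
open Polynomial in
/-- The restriction of a multivariate polynomial to the `j`-th axis: the `k`-th variable is
specialised to `D j k` for `k ≠ j`, and the `j`-th variable stays free. -/
noncomputable def axisRestriction {R ι : Type*} [CommRing R] [DecidableEq ι]
    (D : ι → ι → R) (j : ι) : MvPolynomial ι R →ₐ[R] R[X] :=
  MvPolynomial.aeval fun k => if k = j then X else C (D j k)

section AxisRestriction

variable {R A ι : Type*} [CommRing R] [CommRing A] [Algebra R A] [DecidableEq ι]
  (D : ι → ι → R)

theorem aeval_axisRestriction (j : ι) (y : A) (f : MvPolynomial ι R) :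
    Polynomial.aeval y (axisRestriction D j f) =
      MvPolynomial.aeval (fun k => if k = j then y else algebraMap R A (D j k)) f := by
  rw [axisRestriction, ← AlgHom.comp_apply, MvPolynomial.comp_aeval]
  congr 2
  funext k
  split_ifs <;> simp

theorem eval_axisRestriction (j : ι) (r : R) (f : MvPolynomial ι R) :
    (axisRestriction D j f).eval r =
      MvPolynomial.eval (fun k => if k = j then r else D j k) f := by
  simpa [Polynomial.coe_aeval_eq_eval, MvPolynomial.aeval_eq_eval] using
    aeval_axisRestriction (A := R) D j r f

theorem axisRestriction_X_self (j : ι) :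
    axisRestriction D j (MvPolynomial.X j) = Polynomial.X := by
  simp [axisRestriction]

theorem axisRestriction_X_of_ne {j m : ι} (h : m ≠ j) :
    axisRestriction D j (MvPolynomial.X m) = Polynomial.C (D j m) := by
  simp [axisRestriction, h]

theorem Polynomial.aeval_mul_eq_of_sub_mul_eq_zero {y z : A} {a : R}
    (h : (y - algebraMap R A a) * z = 0) (p : Polynomial R) :
    Polynomial.aeval y p * z = algebraMap R A (p.eval a) * z := by
  obtain ⟨q, hq⟩ := Polynomial.X_sub_C_dvd_sub_C_eval (a := a) (p := p)
  have hp := congrArg (Polynomial.aeval y) hq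
  simp only [map_sub, map_mul, Polynomial.aeval_X, Polynomial.aeval_C] at hp
  linear_combination z * hp + Polynomial.aeval y q * h

variable [Fintype ι]

theorem sum_eval_axisRestriction_congr
    (hD : ∀ i j k, i ≠ j → i ≠ k → j ≠ k → (D i j - D k j) * (D i k - D j k) = 0)
    (f : MvPolynomial ι R) (i m : ι) :
    ∑ j ∈ Finset.univ.erase i, (axisRestriction D j f).eval (D i j) =
      ∑ j ∈ Finset.univ.erase m, (axisRestriction D j f).eval (D m j) := by
  induction f using MvPolynomial.induction_on generalizing i m with
  | C a => simp [axisRestriction, Finset.card_erase_of_mem]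
  | add p q hp hq =>
    simp only [map_add, Polynomial.eval_add, Finset.sum_add_distrib, hp i m, hq i m]
  | mul_X f l hf =>
    suffices key : ∀ i, ∑ j ∈ Finset.univ.erase i,
        (axisRestriction D j (f * MvPolynomial.X l)).eval (D i j) =
        ∑ j ∈ Finset.univ.erase l,
          (axisRestriction D j (f * MvPolynomial.X l)).eval (D l j) by
      rw [key i, key m]
    intro i
    obtain rfl | hil := eq_or_ne i l
    · rfl
    have hl : l ∈ (Finset.univ : Finset ι).erase i := by simp [hil.symm]
    have hi : i ∈ (Finset.univ : Finset ι).erase l := by simp [hil]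
    have hfil := hf i l
    rw [← Finset.add_sum_erase _ _ hl, ← Finset.add_sum_erase _ _ hi,
      Finset.erase_right_comm (a := l)] at hfil ⊢
    have hterm : ∀ j ∈ (Finset.univ.erase i).erase l,
        (axisRestriction D j (f * MvPolynomial.X l)).eval (D i j) -
          (axisRestriction D j (f * MvPolynomial.X l)).eval (D l j) =
        D i l * ((axisRestriction D j f).eval (D i j) -
          (axisRestriction D j f).eval (D l j)) := by
      intro j hj
      simp only [Finset.mem_erase, Finset.mem_univ, and_true] at hj
      obtain ⟨q, hq⟩ := Polynomial.sub_dvd_eval_sub (D i j) (D l j) (axisRestriction D j f)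
      simp only [map_mul, axisRestriction_X_of_ne D hj.1.symm, Polynomial.eval_mul,
        Polynomial.eval_C]
      linear_combination (D j l - D i l) * hq - q * hD i j l hj.2.symm hil hj.1
    have hsum := Finset.sum_congr rfl hterm
    rw [← Finset.mul_sum, Finset.sum_sub_distrib, Finset.sum_sub_distrib] at hsum
    simp only [map_mul, axisRestriction_X_self, axisRestriction_X_of_ne D hil.symm,
      Polynomial.eval_mul, Polynomial.eval_C, Polynomial.eval_X] at hsum ⊢
    linear_combination hsum + D i l * hfil

/-- If the `x i` satisfy the equations of a union of axes, then `f(x)` is the sum of the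
restrictions of `f` to the axes, up to a constant. -/
theorem aeval_eq_sum_aeval_axisRestriction (x : ι → A)
    (hx : ∀ i j, i ≠ j →
      (x i - algebraMap R A (D j i)) * (x j - algebraMap R A (D i j)) = 0)
    (hD : ∀ i j k, i ≠ j → i ≠ k → j ≠ k → (D i j - D k j) * (D i k - D j k) = 0)
    (f : MvPolynomial ι R) (i : ι) :
    MvPolynomial.aeval x f = ∑ j, Polynomial.aeval (x j) (axisRestriction D j f) -
      algebraMap R A (∑ j ∈ Finset.univ.erase i, (axisRestriction D j f).eval (D i j)) := by
  induction f using MvPolynomial.induction_on generalizing i with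
  | C a =>
    have hc := Finset.add_sum_erase Finset.univ (fun _ : ι => algebraMap R A a)
      (Finset.mem_univ i)
    simpa [axisRestriction] using eq_sub_of_add_eq hc
  | add p q hp hq =>
    simp only [map_add, Polynomial.eval_add, Finset.sum_add_distrib, hp i, hq i]
    ring
  | mul_X f l hf =>
    rw [sum_eval_axisRestriction_congr D hD _ i l, map_mul, hf l, MvPolynomial.aeval_X,
      ← Finset.add_sum_erase _ _ (Finset.mem_univ l),
      ← Finset.add_sum_erase _ (fun j => Polynomial.aeval (x j) _) (Finset.mem_univ l)]
    have hterm : ∀ j ∈ Finset.univ.erase l,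
        Polynomial.aeval (x j) (axisRestriction D j f) * x l -
          algebraMap R A ((axisRestriction D j f).eval (D l j)) * x l =
        Polynomial.aeval (x j) (axisRestriction D j (f * MvPolynomial.X l)) -
          algebraMap R A ((axisRestriction D j (f * MvPolynomial.X l)).eval (D l j)) := by
      intro j hj
      have hjl := Finset.ne_of_mem_erase hj
      simp only [map_mul, axisRestriction_X_of_ne D hjl.symm, Polynomial.eval_mul,
        Polynomial.eval_C, Polynomial.aeval_C]
      linear_combination Polynomial.aeval_mul_eq_of_sub_mul_eq_zero (hx j l hjl)
        (axisRestriction D j f)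
    have hsum := Finset.sum_congr rfl hterm
    simp only [Finset.sum_sub_distrib, ← Finset.sum_mul, ← map_sum] at hsum
    have hself : Polynomial.aeval (x l) (axisRestriction D l (f * MvPolynomial.X l)) =
        Polynomial.aeval (x l) (axisRestriction D l f) * x l := by
      simp [axisRestriction_X_self]
    rw [hself]
    linear_combination hsum

end AxisRestriction

section Integration

variable {R A ι : Type*} [CommRing R] [CommRing A] [Algebra R A]
  (D : ι → ι → R) (x : ι → A) (ν : A) (G : ι → R) (int : A →ₗ[R] R)

theorem map_algebraMap_mul (r : R) (a : A) : int (algebraMap R A r * a) = r * int a := by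
  rw [← Algebra.smul_def, map_smul, smul_eq_mul]

variable [DecidableEq ι] [Fintype ι]

theorem integral_sq
    (hxsq : ∀ i, x i ^ 2 =
      ν + (∑ j ∈ Finset.univ.erase i, algebraMap R A (D i j) * x j) + algebraMap R A (G i))
    (h1 : int 1 = 0) (hx : ∀ j, int (x j) = 0) (hnu : int ν = 1) (i : ι) :
    int (x i ^ 2) = 1 := by
  have hG : int (algebraMap R A (G i)) = 0 := by
    rw [← mul_one (algebraMap R A _), map_algebraMap_mul, h1, mul_zero]
  simp [hxsq, map_sum, map_algebraMap_mul, hx, hnu, hG]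

/-- The second integration formula for a polynomial in a single variable. -/
theorem integral_aeval_mul_euler
    (hxx : ∀ i j, i ≠ j →
      (x i - algebraMap R A (D j i)) * (x j - algebraMap R A (D i j)) = 0)
    (hxsq : ∀ i, x i ^ 2 =
      ν + (∑ j ∈ Finset.univ.erase i, algebraMap R A (D i j) * x j) + algebraMap R A (G i))
    (h1 : int 1 = 0) (hx : ∀ j, int (x j) = 0) (hnu : int ν = 1)
    (p : Polynomial R) (j : ι) :
    int (Polynomial.aeval (x j) p * (2 * ν + ∑ k, x k ^ 2)) =
      int (Polynomial.aeval (x j) p * (3 * x j ^ 2 -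
        algebraMap R A (2 * G j + ∑ k ∈ Finset.univ.erase j, D j k ^ 2))) +
      ∑ k ∈ Finset.univ.erase j, p.eval (D k j) := by
  have hterm : ∀ k ∈ Finset.univ.erase j,
      int (Polynomial.aeval (x j) p *
        (x k ^ 2 - 2 * (algebraMap R A (D j k) * x k) + algebraMap R A (D j k ^ 2))) =
      p.eval (D k j) := by
    intro k hk
    have hxjk := hxx j k (Finset.ne_of_mem_erase hk).symm
    have hp := Polynomial.aeval_mul_eq_of_sub_mul_eq_zero hxjk p
    have hmul : Polynomial.aeval (x j) p *
        (x k ^ 2 - 2 * (algebraMap R A (D j k) * x k) + algebraMap R A (D j k ^ 2)) =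
        algebraMap R A (p.eval (D k j)) * (x k ^ 2 -
          (algebraMap R A (2 * D j k) * x k - algebraMap R A (D j k ^ 2) * 1)) := by
      simp only [map_mul, map_pow, map_ofNat]
      linear_combination (x k - algebraMap R A (D j k)) * hp
    rw [hmul, map_algebraMap_mul, map_sub, map_sub, map_algebraMap_mul, map_algebraMap_mul,
      integral_sq D x ν G int hxsq h1 hx hnu, hx, h1]
    ring
  rw [← Finset.sum_congr rfl hterm, ← map_sum, ← map_add]
  congr 1
  simp only [← Finset.mul_sum, Finset.sum_add_distrib, Finset.sum_sub_distrib, map_add, map_mul,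
    map_sum, map_ofNat]
  rw [← Finset.add_sum_erase _ _ (Finset.mem_univ j)]
  linear_combination -2 * Polynomial.aeval (x j) p * hxsq j

end Integration


/-- The second integration formula:
`∫(f(x_1,…,x_n)·e) = Σ_j ∫(f_j(x_j)·(3x_j² − B_j)) − 2·Σ_{j≠i} f_j(D_{ij})`,
where `e = 2ν + x_1² + ⋯ + x_n²`. -/
theorem stmt_7 (R A : Type*) [CommRing R] [CommRing A] [Algebra R A]
    (n : ℕ) (hn : 1 ≤ n)
    (x : Fin n → A) (ν : A)
    (D : Fin n → Fin n → R) (G J : Fin n → R)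
    (hxx : ∀ i j, i ≠ j → x i * x j =
      algebraMap R A (D i j) * x i + algebraMap R A (D j i) * x j
        - algebraMap R A (D i j * D j i))
    (hxsq : ∀ i, x i ^ 2 =
      ν + (∑ j ∈ Finset.univ.erase i, algebraMap R A (D i j) * x j)
        + algebraMap R A (G i))
    (hxnu : ∀ i, x i * ν =
      algebraMap R A (G i) * x i
        - (∑ j ∈ Finset.univ.erase i, algebraMap R A (D i j * D j i) * x j)
        + algebraMap R A (J i))
    (B : Fin n → R)
    (hB : ∀ i, B i = 2 * G i + ∑ j ∈ Finset.univ.erase i, D i j ^ 2)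
    (hD : ∀ i j k, i ≠ j → i ≠ k → j ≠ k →
      (D i j - D k j) * (D i k - D j k) = 0)
    (hGG : ∀ i j, i ≠ j →
      G i + G j + (∑ k ∈ (Finset.univ.erase i).erase j, D i k * D j k)
        = D i j ^ 2 + D j i ^ 2)
    (int : A →ₗ[R] R)
    (h1 : int 1 = 0)
    (hx : ∀ j, int (x j) = 0)
    (hnu : int ν = 1)
    (i : Fin n) (f : MvPolynomial (Fin n) R) :
    int (MvPolynomial.aeval x f * (2 * ν + ∑ j, x j ^ 2)) =
      (∑ j, int (MvPolynomial.aeval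
          (fun k => if k = j then x j else algebraMap R A (D j k)) f
        * (3 * x j ^ 2 - algebraMap R A (B j))))
      - 2 * ∑ j ∈ Finset.univ.erase i,
          MvPolynomial.eval (fun k => if k = j then D i j else D j k) f := by
  have hxx' : ∀ i j, i ≠ j →
      (x i - algebraMap R A (D j i)) * (x j - algebraMap R A (D i j)) = 0 := by
    intro i j hij
    have h := hxx i j hij
    rw [map_mul] at h
    linear_combination h
  have hone : int (2 * ν + ∑ j, x j ^ 2) = n + 2 := by
    rw [two_mul]
    simp only [map_add, map_sum, hnu, integral_sq D x ν G int hxsq h1 hx hnu]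
    simp
    ring
  have hconst : ∑ j, ∑ k ∈ Finset.univ.erase j, (axisRestriction D j f).eval (D k j) =
      n * ∑ j ∈ Finset.univ.erase i, (axisRestriction D j f).eval (D i j) := by
    rw [Finset.sum_comm' (t' := Finset.univ) (s' := fun k => Finset.univ.erase k)
        (by simp [eq_comm]),
      Finset.sum_congr rfl fun k _ => sum_eval_axisRestriction_congr D hD f k i,
      Finset.sum_const, Finset.card_univ, Fintype.card_fin, nsmul_eq_mul]
  simp only [← aeval_axisRestriction, ← eval_axisRestriction, hB]
  rw [aeval_eq_sum_aeval_axisRestriction D x hxx' hD f i, sub_mul, map_sub,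
    map_algebraMap_mul, hone, Finset.sum_mul, map_sum]
  simp only [integral_aeval_mul_euler D x ν G int hxx' hxsq h1 hx hnu, Finset.sum_add_distrib]
  rw [hconst]
  ring
end

section
/- Let R be a commutative ring, A a commutative R-algebra, n ≥ 1, x_1,…,x_n ∈ A, and D_{ij} ∈ R for i ≠ j, B_1,…,B_n, μ, λ ∈ R (scalars in R are identified with their images in A). Assume: (x_i − D_{ji})·(x_j − D_{ij}) = 0 in A for all i ≠ j; (D_{ij} − D_{kj})·(D_{ik} − D_{jk}) = 0 in R for all pairwise distinct i, j, k; 3·Σ_{j≠i} D_{ij}² + μ = 2·B_i for every i; and λ = −Σ_{j≠i}(3·D_{ij}² − B_j)² for every i. Let p₁ = 3·(x_1² + ⋯ + x_n²) + μ ∈ A and let e ∈ A be an element satisfying e² = Σ_{i=1}^n (3·x_i² − B_i)² + λ. Let ∫ : A → R be an R-linear map with ∫(r·1) = 0 for every r ∈ R. Then for all integers a, b ≥ 0: ∫(p₁^a·e^{2b}) = Σ_{i=1}^n ∫((3·x_i² + 2·B_i)^a·(3·x_i² − B_i)^{2b}). -/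
/-- If `(w i - D j i) * (w j - D i j) = 0` for all `i ≠ j`, then every polynomial in the `w i` is a
linear combination of `1` and of pure powers of the `w i`. -/
lemma mem_span_pow_of_mem_adjoin {ι R A : Type*} [CommRing R] [CommRing A] [Algebra R A]
    (w : ι → A) (D : ι → ι → R)
    (hw : ∀ i j, i ≠ j →
      (w i - algebraMap R A (D j i)) * (w j - algebraMap R A (D i j)) = 0)
    {z : A} (hz : z ∈ Algebra.adjoin R (Set.range w)) :
    z ∈ Submodule.span R (insert 1 (Set.range fun p : ι × ℕ => w p.1 ^ p.2)) := by
  set M := Submodule.span R (insert 1 (Set.range fun p : ι × ℕ => w p.1 ^ p.2)) with hM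
  have one_mem : (1 : A) ∈ M := Submodule.subset_span (Set.mem_insert _ _)
  have pow_mem : ∀ i m, w i ^ m ∈ M := fun i m =>
    Submodule.subset_span (Set.mem_insert_of_mem _ ⟨(i, m), rfl⟩)
  have mul_pow_mem : ∀ i j m, w i * w j ^ m ∈ M := by
    intro i j m
    by_cases hij : i = j
    · subst hij
      rw [← pow_succ']
      exact pow_mem _ _
    induction m with
    | zero => simpa using pow_mem i 1
    | succ m ih =>
      have h : w i * w j ^ (m + 1) = D i j • (w i * w j ^ m) + D j i • w j ^ (m + 1)
          - (D i j * D j i) • w j ^ m := by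
        simp only [Algebra.smul_def, map_mul]
        linear_combination w j ^ m * hw i j hij
      rw [h]
      exact M.sub_mem (M.add_mem (M.smul_mem _ ih) (M.smul_mem _ (pow_mem _ _)))
        (M.smul_mem _ (pow_mem _ _))
  have gen_mul_mem : ∀ i, ∀ y ∈ M, w i * y ∈ M := by
    intro i y hy
    induction hy using Submodule.span_induction with
    | mem y hy =>
      rcases hy with rfl | ⟨p, rfl⟩
      · simpa using pow_mem i 1
      · exact mul_pow_mem _ _ _
    | zero => simp
    | add y z _ _ hy hz => rw [mul_add]; exact M.add_mem hy hz
    | smul r y _ hy => rw [mul_smul_comm]; exact M.smul_mem _ hy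
  have mul_mem : ∀ y ∈ M, z * y ∈ M := by
    induction hz using Algebra.adjoin_induction with
    | mem z hz =>
      obtain ⟨i, rfl⟩ := hz
      exact gen_mul_mem i
    | algebraMap r =>
      intro y hy
      rw [← Algebra.smul_def]
      exact M.smul_mem _ hy
    | add u v _ _ hu hv =>
      intro y hy
      rw [add_mul]
      exact M.add_mem (hu y hy) (hv y hy)
    | mul u v _ _ hu hv =>
      intro y hy
      rw [mul_assoc]
      exact hu _ (hv y hy)
  simpa using mul_mem 1 one_mem

open Polynomial in
/-- The `i`-th coordinate on `A` together with its restrictions to the lines `j`, on which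
the `j`-th coordinate is free and the `i`-th one, for `i ≠ j`, is the constant `D j i`. -/
noncomputable def lineCoord {ι R A : Type*} [DecidableEq ι] [CommRing R]
    (x : ι → A) (D : ι → ι → R) (i : ι) : A × (ι → R[X]) :=
  (x i, fun j => if j = i then X else C (D j i))

open Polynomial in
lemma lineCoord_rel {ι R A : Type*} [DecidableEq ι] [CommRing R] [CommRing A] [Algebra R A]
    (x : ι → A) (D : ι → ι → R)
    (hxx : ∀ i j, i ≠ j →
      (x i - algebraMap R A (D j i)) * (x j - algebraMap R A (D i j)) = 0)
    (hD : ∀ i j k, i ≠ j → i ≠ k → j ≠ k → (D i j - D k j) * (D i k - D j k) = 0)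
    (i j : ι) (hij : i ≠ j) :
    (lineCoord x D i - algebraMap R (A × (ι → R[X])) (D j i)) *
      (lineCoord x D j - algebraMap R (A × (ι → R[X])) (D i j)) = 0 := by
  refine Prod.ext (hxx i j hij) (funext fun k => ?_)
  change ((if k = i then X else C (D k i)) - C (D j i)) *
    ((if k = j then X else C (D k j)) - C (D i j)) = 0
  by_cases hki : k = i
  · subst hki
    simp [hij]
  by_cases hkj : k = j
  · subst hkj
    simp [hki]
  rw [if_neg hki, if_neg hkj, ← C_sub, ← C_sub, ← C_mul, hD k i j hki hkj hij, C_0]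

open Polynomial in
/-- Modulo constants, a polynomial in the coordinates is the sum of its restrictions to the
lines. -/
lemma map_fst_eq_sum_of_mem_adjoin_lineCoord {ι R A : Type*} [Fintype ι] [DecidableEq ι]
    [CommRing R] [CommRing A] [Algebra R A] (x : ι → A) (D : ι → ι → R)
    (hxx : ∀ i j, i ≠ j →
      (x i - algebraMap R A (D j i)) * (x j - algebraMap R A (D i j)) = 0)
    (hD : ∀ i j k, i ≠ j → i ≠ k → j ≠ k → (D i j - D k j) * (D i k - D j k) = 0)
    (int : A →ₗ[R] R) (hscalar : ∀ r : R, int (algebraMap R A r) = 0)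
    {z : A × (ι → R[X])} (hz : z ∈ Algebra.adjoin R (Set.range (lineCoord x D))) :
    int z.1 = ∑ i, int (aeval (x i) (z.2 i)) := by
  have h := mem_span_pow_of_mem_adjoin _ D (lineCoord_rel x D hxx hD) hz
  clear hz
  induction h using Submodule.span_induction with
  | mem z hz =>
    rcases hz with rfl | ⟨⟨i, m⟩, rfl⟩
    · have h1 : int 1 = 0 := by simpa using hscalar 1
      simp [h1]
    · rw [Finset.sum_eq_single i]
      · simp [lineCoord]
      · intro j _ hji
        simp only [lineCoord, Prod.pow_snd, Pi.pow_apply, if_neg hji, map_pow, aeval_C]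
        rw [← map_pow, hscalar]
      · simp
  | zero => simp
  | add u v _ _ hu hv => simp [hu, hv, Finset.sum_add_distrib]
  | smul r u _ hu => simp [hu, Finset.mul_sum]


/-- Diagonalisation of the even tautological integrals:
`∫(p₁^a·e^{2b}) = Σ_i ∫((3x_i² + 2B_i)^a·(3x_i² − B_i)^{2b})`. -/
theorem stmt_8 (R A : Type*) [CommRing R] [CommRing A] [Algebra R A]
    (n : ℕ) (hn : 1 ≤ n)
    (x : Fin n → A) (D : Fin n → Fin n → R) (B : Fin n → R) (μ lam : R)
    (hxx : ∀ i j, i ≠ j →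
      (x i - algebraMap R A (D j i)) * (x j - algebraMap R A (D i j)) = 0)
    (hD : ∀ i j k, i ≠ j → i ≠ k → j ≠ k →
      (D i j - D k j) * (D i k - D j k) = 0)
    (hmu : ∀ i, 3 * (∑ j ∈ Finset.univ.erase i, D i j ^ 2) + μ = 2 * B i)
    (hlam : ∀ i, lam = -∑ j ∈ Finset.univ.erase i, (3 * D i j ^ 2 - B j) ^ 2)
    (p1 e : A)
    (hp1 : p1 = 3 * (∑ i, x i ^ 2) + algebraMap R A μ)
    (he : e ^ 2 = (∑ i, (3 * x i ^ 2 - algebraMap R A (B i)) ^ 2) + algebraMap R A lam)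
    (int : A →ₗ[R] R)
    (hscalar : ∀ r : R, int (algebraMap R A r) = 0) :
    ∀ a b : ℕ, int (p1 ^ a * e ^ (2 * b)) =
      ∑ i, int ((3 * x i ^ 2 + algebraMap R A (2 * B i)) ^ a
        * (3 * x i ^ 2 - algebraMap R A (B i)) ^ (2 * b)) := by
  intro a b
  let W := A × (Fin n → Polynomial R)
  let w : Fin n → W := lineCoord x D
  let S := Algebra.adjoin R (Set.range w)
  let P : W := 3 * (∑ i, w i ^ 2) + algebraMap R W μ
  let Q : W := (∑ i, (3 * w i ^ 2 - algebraMap R W (B i)) ^ 2) + algebraMap R W lam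
  have hw : ∀ i, w i ∈ S := fun i => Algebra.subset_adjoin ⟨i, rfl⟩
  have h3 : (3 : W) ∈ S := ofNat_mem S 3
  have hP : P ∈ S := S.add_mem
    (S.mul_mem h3 (S.sum_mem fun i _ => S.pow_mem (hw i) 2)) (S.algebraMap_mem μ)
  have hQ : Q ∈ S := S.add_mem (S.sum_mem fun i _ => S.pow_mem
    (S.sub_mem (S.mul_mem h3 (S.pow_mem (hw i) 2)) (S.algebraMap_mem _)) 2) (S.algebraMap_mem lam)
  have key := map_fst_eq_sum_of_mem_adjoin_lineCoord x D hxx hD int hscalar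
    (S.mul_mem (S.pow_mem hP a) (S.pow_mem hQ b))
  have hw1 : ∀ i, (w i).1 = x i := fun _ => rfl
  have hw2 : ∀ i, (w i).2 i = Polynomial.X := fun i => if_pos rfl
  have hw3 : ∀ i j, j ≠ i → (w j).2 i = Polynomial.C (D i j) := fun i j h => if_neg h.symm
  have hP1 : P.1 = p1 := by
    rw [hp1]
    simp [P, W, Prod.fst_sum, hw1]
  have hQ1 : Q.1 = e ^ 2 := by
    rw [he]
    simp [Q, W, Prod.fst_sum, hw1]
  have hP2 : ∀ i, P.2 i = 3 * Polynomial.X ^ 2 + Polynomial.C (2 * B i) := by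
    intro i
    have h : P.2 i = 3 * (∑ j, (w j).2 i ^ 2) + Polynomial.C μ := by
      simp [P, W, Prod.snd_sum, Finset.sum_apply]
    rw [h, ← Finset.add_sum_erase _ _ (Finset.mem_univ i), hw2,
      Finset.sum_congr rfl fun j hj => by rw [hw3 i j (Finset.ne_of_mem_erase hj)], ← hmu i]
    simp only [map_add, map_mul, map_sum, map_pow, map_ofNat]
    ring
  have hQ2 : ∀ i, Q.2 i = (3 * Polynomial.X ^ 2 - Polynomial.C (B i)) ^ 2 := by
    intro i
    have h : Q.2 i = (∑ j, (3 * (w j).2 i ^ 2 - Polynomial.C (B j)) ^ 2) + Polynomial.C lam := by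
      simp [Q, W, Prod.snd_sum, Finset.sum_apply]
    rw [h, ← Finset.add_sum_erase _ _ (Finset.mem_univ i), hw2,
      Finset.sum_congr rfl fun j hj => by rw [hw3 i j (Finset.ne_of_mem_erase hj)], hlam i]
    simp only [map_neg, map_sub, map_mul, map_sum, map_pow, map_ofNat]
    ring
  have hfst : (P ^ a * Q ^ b).1 = P.1 ^ a * Q.1 ^ b := rfl
  have hsnd : ∀ i, (P ^ a * Q ^ b).2 i = P.2 i ^ a * Q.2 i ^ b := fun _ => rfl
  simpa only [hfst, hsnd, hP1, hQ1, hP2, hQ2, ← pow_mul, map_mul, map_add, map_sub, map_pow,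
    map_ofNat, Polynomial.aeval_X, Polynomial.aeval_C] using key
end

section
/- With the setup below, set e = 2·ν + x_1² + ⋯ + x_n² ∈ A and p₁ = 3·(x_1² + ⋯ + x_n²) + μ ∈ A, and assume e² = Σ_{j=1}^n (3·x_j² − B_j)² + λ. Then for every fixed index i and all integers a, b ≥ 0: ∫(p₁^a·e^{2b+1}) = Σ_{j=1}^n ∫((3·x_j² + 2·B_j)^a·(3·x_j² − B_j)^{2b+1}) − 2·Σ_{j ≠ i} (3·D_{ij}² + 2·B_j)^a·(3·D_{ij}² − B_j)^{2b}. -/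
/-- If two elements are sums of local contributions `X j`, `Y j`, normalised at every base index
`i` by the scalars `U i j`, `V i j`, then their product is the sum of the local products. -/
theorem mul_eq_sum_mul_sub_sum_erase {ι A : Type*} [Fintype ι] [DecidableEq ι] [CommRing A]
    (X Y : ι → A) (U V : ι → ι → A)
    (hXY : ∀ i j, i ≠ j → (X i - U j i) * (Y j - V i j) = 0)
    (hUV : ∀ i j k, i ≠ j → i ≠ k → j ≠ k → (U i j - U k j) * (V i k - V j k) = 0)
    (u v : A)
    (hu : ∀ i, u = ∑ j, X j - ∑ j ∈ Finset.univ.erase i, U i j)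
    (hv : ∀ i, v = ∑ j, Y j - ∑ j ∈ Finset.univ.erase i, V i j) (i : ι) :
    u * v = ∑ j, X j * Y j - ∑ j ∈ Finset.univ.erase i, U i j * V i j := by
  have hu' : ∀ i, u = X i + ∑ j ∈ Finset.univ.erase i, (X j - U i j) := fun i => by
    rw [hu i, ← Finset.add_sum_erase _ _ (Finset.mem_univ i), Finset.sum_sub_distrib]; ring
  have hv' : v = Y i + ∑ j ∈ Finset.univ.erase i, (Y j - V i j) := by
    rw [hv i, ← Finset.add_sum_erase _ _ (Finset.mem_univ i), Finset.sum_sub_distrib]; ring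
  have h₁ : ∀ j ∈ Finset.univ.erase i, u * (Y j - V i j) = X j * (Y j - V i j) +
      ∑ k ∈ (Finset.univ.erase i).erase j, (X k - U i k) * (V k j - V i j) := by
    intro j hj
    have hji : j ≠ i := Finset.ne_of_mem_erase hj
    rw [hu' j, add_mul, ← Finset.add_sum_erase _ _
      (Finset.mem_erase.2 ⟨hji.symm, Finset.mem_univ i⟩), add_mul, hXY i j hji.symm, zero_add,
      Finset.erase_right_comm, Finset.sum_mul]
    congr 1
    refine Finset.sum_congr rfl fun k hk => ?_
    have hkj : k ≠ j := Finset.ne_of_mem_erase hk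
    have hki : k ≠ i := Finset.ne_of_mem_erase (Finset.mem_of_mem_erase hk)
    linear_combination hXY k j hkj - hUV i k j hki.symm hji.symm hkj
  have h₂ : ∀ k ∈ Finset.univ.erase i,
      ∑ j ∈ (Finset.univ.erase i).erase k, (X k - U i k) * (V k j - V i j) =
        (X k - U i k) * (V i k - V k i) := by
    intro k hk
    have hki : k ≠ i := Finset.ne_of_mem_erase hk
    rw [← Finset.mul_sum, Finset.sum_sub_distrib]
    congr 1
    have e₁ := Finset.add_sum_erase _ (V i) hk
    have e₂ := Finset.add_sum_erase _ (V k) (Finset.mem_erase.2 ⟨hki.symm, Finset.mem_univ i⟩)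
    rw [Finset.erase_right_comm] at e₂
    linear_combination e₂ - e₁ - hv i + hv k
  have h₃ : u * Y i = X i * Y i + ∑ k ∈ Finset.univ.erase i, (X k - U i k) * V k i := by
    rw [hu' i, add_mul, Finset.sum_mul]
    congr 1
    refine Finset.sum_congr rfl fun k hk => ?_
    linear_combination hXY k i (Finset.ne_of_mem_erase hk)
  have h₄ : ∑ j ∈ Finset.univ.erase i, ∑ k ∈ (Finset.univ.erase i).erase j,
      (X k - U i k) * (V k j - V i j) =
      ∑ k ∈ Finset.univ.erase i, (X k - U i k) * (V i k - V k i) := by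
    rw [← Finset.sum_congr rfl h₂]
    refine Finset.sum_comm' fun j k => ?_
    simp only [Finset.mem_erase, Finset.mem_univ, and_true]
    tauto
  rw [hv', mul_add, h₃, Finset.mul_sum, Finset.sum_congr rfl h₁, Finset.sum_add_distrib, h₄,
    ← Finset.add_sum_erase _ _ (Finset.mem_univ i), add_assoc, add_sub_assoc,
    ← Finset.sum_sub_distrib, ← Finset.sum_add_distrib, ← Finset.sum_add_distrib]
  congr 1
  exact Finset.sum_congr rfl fun k _ => by ring

open Polynomial in
/-- `u` is the sum of the local contributions `(f j)(x j)`, normalised at every base index `i` by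
the values of `f j` at `d i j`. -/
def IsDiagonal {ι A : Type*} [Fintype ι] [DecidableEq ι] [CommRing A]
    (x : ι → A) (d : ι → ι → A) (u : A) (f : ι → A[X]) : Prop :=
  ∀ i, u = ∑ j, (f j).eval (x j) - ∑ j ∈ Finset.univ.erase i, (f j).eval (d i j)

namespace IsDiagonal

open Polynomial

variable {ι A : Type*} [Fintype ι] [DecidableEq ι] [CommRing A] {x : ι → A} {d : ι → ι → A}

theorem one : IsDiagonal x d 1 (fun _ => 1) := fun i => by
  rw [← Finset.add_sum_erase _ _ (Finset.mem_univ i)]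
  simp only [eval_one]
  ring

theorem mul (hx : ∀ i j, i ≠ j → (x i - d j i) * (x j - d i j) = 0)
    (hd : ∀ i j k, i ≠ j → i ≠ k → j ≠ k → (d i j - d k j) * (d i k - d j k) = 0)
    {u v : A} {f g : ι → A[X]} (hu : IsDiagonal x d u f) (hv : IsDiagonal x d v g) :
    IsDiagonal x d (u * v) (fun j => f j * g j) := fun i => by
  have key : ∀ (p q : A[X]) (a b a' b' : A), (a - b) * (a' - b') = 0 →
      (p.eval a - p.eval b) * (q.eval a' - q.eval b') = 0 := fun p q a b a' b' h =>
    zero_dvd_iff.1 (h ▸ mul_dvd_mul (sub_dvd_eval_sub a b p) (sub_dvd_eval_sub a' b' q))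
  simp only [eval_mul]
  exact mul_eq_sum_mul_sub_sum_erase (fun j => (f j).eval (x j)) (fun j => (g j).eval (x j))
    (fun i j => (f j).eval (d i j)) (fun i j => (g j).eval (d i j))
    (fun i j hij => key _ _ _ _ _ _ (hx i j hij))
    (fun i j k hij hik hjk => key _ _ _ _ _ _ (hd i j k hij hik hjk)) u v hu hv i

theorem pow (hx : ∀ i j, i ≠ j → (x i - d j i) * (x j - d i j) = 0)
    (hd : ∀ i j k, i ≠ j → i ≠ k → j ≠ k → (d i j - d k j) * (d i k - d j k) = 0)
    {u : A} {f : ι → A[X]} (hu : IsDiagonal x d u f) (m : ℕ) :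
    IsDiagonal x d (u ^ m) (fun j => f j ^ m) := by
  induction m with
  | zero => simpa only [pow_zero] using one
  | succ m ih => simpa only [pow_succ] using ih.mul hx hd hu

end IsDiagonal


/-- Diagonalisation of the odd tautological integrals:
`∫(p₁^a·e^{2b+1}) = Σ_j ∫((3x_j² + 2B_j)^a·(3x_j² − B_j)^{2b+1})
  − 2·Σ_{j≠i} (3D_{ij}² + 2B_j)^a·(3D_{ij}² − B_j)^{2b}`. -/
theorem stmt_9 (R A : Type*) [CommRing R] [CommRing A] [Algebra R A]
    (n : ℕ) (hn : 1 ≤ n)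
    (x : Fin n → A) (ν : A)
    (D : Fin n → Fin n → R) (G J : Fin n → R)
    (hxx : ∀ i j, i ≠ j → x i * x j =
      algebraMap R A (D i j) * x i + algebraMap R A (D j i) * x j
        - algebraMap R A (D i j * D j i))
    (hxsq : ∀ i, x i ^ 2 =
      ν + (∑ j ∈ Finset.univ.erase i, algebraMap R A (D i j) * x j)
        + algebraMap R A (G i))
    (hxnu : ∀ i, x i * ν =
      algebraMap R A (G i) * x i
        - (∑ j ∈ Finset.univ.erase i, algebraMap R A (D i j * D j i) * x j)
        + algebraMap R A (J i))
    (B : Fin n → R)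
    (hB : ∀ i, B i = 2 * G i + ∑ j ∈ Finset.univ.erase i, D i j ^ 2)
    (hD : ∀ i j k, i ≠ j → i ≠ k → j ≠ k →
      (D i j - D k j) * (D i k - D j k) = 0)
    (hGG : ∀ i j, i ≠ j →
      G i + G j + (∑ k ∈ (Finset.univ.erase i).erase j, D i k * D j k)
        = D i j ^ 2 + D j i ^ 2)
    (μ lam : R)
    (hmu : ∀ i, 3 * (∑ j ∈ Finset.univ.erase i, D i j ^ 2) + μ = 2 * B i)
    (hlam : ∀ i, lam = -∑ j ∈ Finset.univ.erase i, (3 * D i j ^ 2 - B j) ^ 2)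
    (int : A →ₗ[R] R)
    (h1 : int 1 = 0)
    (hx : ∀ j, int (x j) = 0)
    (hnu : int ν = 1)
    (e p1 : A)
    (he : e = 2 * ν + ∑ j, x j ^ 2)
    (hp1 : p1 = 3 * (∑ j, x j ^ 2) + algebraMap R A μ)
    (hesq : e ^ 2 = (∑ j, (3 * x j ^ 2 - algebraMap R A (B j)) ^ 2) + algebraMap R A lam)
    (i : Fin n) :
    ∀ a b : ℕ, int (p1 ^ a * e ^ (2 * b + 1)) =
      (∑ j, int ((3 * x j ^ 2 + algebraMap R A (2 * B j)) ^ a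
        * (3 * x j ^ 2 - algebraMap R A (B j)) ^ (2 * b + 1)))
      - 2 * ∑ j ∈ Finset.univ.erase i,
          (3 * D i j ^ 2 + 2 * B j) ^ a * (3 * D i j ^ 2 - B j) ^ (2 * b) := by
  intro a b
  have hx0 : ∀ i j, i ≠ j →
      (x i - algebraMap R A (D j i)) * (x j - algebraMap R A (D i j)) = 0 := by
    intro i j hij
    have h := hxx i j hij
    rw [map_mul] at h
    linear_combination h
  have hd0 : ∀ i j k, i ≠ j → i ≠ k → j ≠ k →
      (algebraMap R A (D i j) - algebraMap R A (D k j)) *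
        (algebraMap R A (D i k) - algebraMap R A (D j k)) = 0 := by
    intro i j k hij hik hjk
    rw [← map_sub, ← map_sub, ← map_mul, hD i j k hij hik hjk, map_zero]
  have hp : IsDiagonal x (fun i j => algebraMap R A (D i j)) p1
      (fun j => 3 * Polynomial.X ^ 2 + Polynomial.C (algebraMap R A (2 * B j))) := by
    intro i
    have h := congrArg (algebraMap R A) (hmu i)
    have h2 := Finset.add_sum_erase Finset.univ (fun j => algebraMap R A (2 * B j))
      (Finset.mem_univ i)
    simp only [Polynomial.eval_add, Polynomial.eval_mul, Polynomial.eval_pow, Polynomial.eval_X,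
      Polynomial.eval_C, Polynomial.eval_ofNat, Finset.sum_add_distrib, ← Finset.mul_sum]
    simp only [map_add, map_mul, map_sum, map_pow, map_ofNat] at h h2 ⊢
    linear_combination hp1 + h + h2
  have hq : IsDiagonal x (fun i j => algebraMap R A (D i j)) (e ^ 2)
      (fun j => (3 * Polynomial.X ^ 2 - Polynomial.C (algebraMap R A (B j))) ^ 2) := by
    intro i
    have h := congrArg (algebraMap R A) (hlam i)
    simp only [Polynomial.eval_sub, Polynomial.eval_mul, Polynomial.eval_pow, Polynomial.eval_X,
      Polynomial.eval_C, Polynomial.eval_ofNat]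
    simp only [map_neg, map_sub, map_mul, map_sum, map_pow, map_ofNat] at h
    linear_combination hesq + h
  have hP := (hp.pow hx0 hd0 a).mul hx0 hd0 (hq.pow hx0 hd0 b)
  set f : Fin n → A := fun j => (3 * x j ^ 2 + algebraMap R A (2 * B j)) ^ a
    * (3 * x j ^ 2 - algebraMap R A (B j)) ^ (2 * b) with hf
  set H : Fin n → Fin n → R := fun k j =>
    (3 * D k j ^ 2 + 2 * B j) ^ a * (3 * D k j ^ 2 - B j) ^ (2 * b) with hH
  have hPe : ∀ k, p1 ^ a * e ^ (2 * b) =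
      ∑ j, f j - algebraMap R A (∑ j ∈ Finset.univ.erase k, H k j) := by
    intro k
    have h := hP k
    simp only [Polynomial.eval_add, Polynomial.eval_sub, Polynomial.eval_mul, Polynomial.eval_pow,
      Polynomial.eval_X, Polynomial.eval_C, Polynomial.eval_ofNat, ← pow_mul] at h
    rw [h]
    simp only [hf, hH, map_add, map_sub, map_mul, map_sum, map_pow, map_ofNat]
  have hint : ∀ (r : R) (y : A), int (algebraMap R A r * y) = r * int y := fun r y => by
    rw [← Algebra.smul_def, map_smul, smul_eq_mul]
  have hint1 : ∀ r : R, int (algebraMap R A r) = 0 := fun r => by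
    rw [← mul_one (algebraMap R A r), hint, h1, mul_zero]
  have hc : ∀ k, ∑ j ∈ Finset.univ.erase k, H k j = ∑ j ∈ Finset.univ.erase i, H i j := by
    intro k
    have h : algebraMap R A (∑ j ∈ Finset.univ.erase k, H k j) =
        algebraMap R A (∑ j ∈ Finset.univ.erase i, H i j) := by
      linear_combination hPe k - hPe i
    simpa only [hint, hnu, mul_one] using congrArg (fun y => int (y * ν)) h
  have hsq : ∀ j, int (x j ^ 2) = 1 := by
    intro j
    rw [hxsq j, map_add, map_add, hnu, hint1, map_sum,
      Finset.sum_eq_zero fun k _ => by rw [hint, hx, mul_zero]]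
    ring
  have hsq' : ∀ k (r : R), int ((x k - algebraMap R A r) ^ 2) = 1 := by
    intro k r
    have h : (x k - algebraMap R A r) ^ 2 =
        x k ^ 2 - algebraMap R A (2 * r) * x k + algebraMap R A (r ^ 2) := by
      simp only [map_mul, map_pow, map_ofNat]; ring
    rw [h, map_add, map_sub, hsq, hint, hx, hint1]
    ring
  have hebase : ∀ j, e = 3 * x j ^ 2 - algebraMap R A (B j) +
      ∑ k ∈ Finset.univ.erase j, (x k - algebraMap R A (D j k)) ^ 2 := by
    intro j
    have h := congrArg (algebraMap R A) (hB j)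
    have h2 := Finset.add_sum_erase Finset.univ (fun k => x k ^ 2) (Finset.mem_univ j)
    have h3 : ∑ k ∈ Finset.univ.erase j, (x k - algebraMap R A (D j k)) ^ 2 =
        ∑ k ∈ Finset.univ.erase j, x k ^ 2 -
          2 * ∑ k ∈ Finset.univ.erase j, algebraMap R A (D j k) * x k +
          ∑ k ∈ Finset.univ.erase j, algebraMap R A (D j k) ^ 2 := by
      rw [Finset.mul_sum, ← Finset.sum_sub_distrib, ← Finset.sum_add_distrib]
      exact Finset.sum_congr rfl fun k _ => by ring
    simp only [map_add, map_mul, map_sum, map_pow, map_ofNat] at h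
    linear_combination he - h2 - h3 - 2 * hxsq j + h
  have hfe : ∀ j k, k ≠ j → (x k - algebraMap R A (D j k)) ^ 2 * f j =
      algebraMap R A (H k j) * (x k - algebraMap R A (D j k)) ^ 2 := by
    intro j k hkj
    let p : Polynomial A := (3 * Polynomial.X ^ 2 + Polynomial.C (algebraMap R A (2 * B j))) ^ a *
      (3 * Polynomial.X ^ 2 - Polynomial.C (algebraMap R A (B j))) ^ (2 * b)
    have hp₁ : f j = p.eval (x j) := by simp [p, hf]
    have hp₂ : algebraMap R A (H k j) = p.eval (algebraMap R A (D k j)) := by simp [p, hH, map_ofNat]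
    obtain ⟨q, hq⟩ := Polynomial.sub_dvd_eval_sub (x j) (algebraMap R A (D k j)) p
    rw [hp₁, hp₂]
    linear_combination (x k - algebraMap R A (D j k)) ^ 2 * hq +
      (x k - algebraMap R A (D j k)) * q * hx0 k j hkj
  have hef : ∀ j, int (e * f j) =
      int ((3 * x j ^ 2 + algebraMap R A (2 * B j)) ^ a
        * (3 * x j ^ 2 - algebraMap R A (B j)) ^ (2 * b + 1)) +
        ∑ k ∈ Finset.univ.erase j, H k j := by
    intro j
    rw [hebase j, add_mul, Finset.sum_mul, map_add, map_sum]
    congr 1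
    · congr 1
      simp only [hf]
      ring
    · refine Finset.sum_congr rfl fun k hk => ?_
      rw [hfe j k (Finset.ne_of_mem_erase hk), hint, hsq', mul_one]
  have hinte : int e = 2 + n := by
    rw [he, map_add, map_sum, two_mul, map_add, hnu, Finset.sum_congr rfl fun j _ => hsq j]
    simp only [Finset.sum_const, Finset.card_univ, Fintype.card_fin, nsmul_eq_mul, mul_one]
    ring
  have hswap : ∑ j, ∑ k ∈ Finset.univ.erase j, H k j =
      n * ∑ j ∈ Finset.univ.erase i, H i j := by
    rw [Finset.sum_comm' (t' := Finset.univ) (s' := fun k => Finset.univ.erase k)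
      (fun j k => by simp [ne_comm]), Finset.sum_congr rfl fun k _ => hc k]
    simp only [Finset.sum_const, Finset.card_univ, Fintype.card_fin, nsmul_eq_mul]
  have hPe' : p1 ^ a * e ^ (2 * b + 1) =
      ∑ j, e * f j - algebraMap R A (∑ j ∈ Finset.univ.erase i, H i j) * e := by
    rw [← Finset.mul_sum]
    linear_combination e * hPe i
  rw [hPe', map_sub, hint, hinte, map_sum, Finset.sum_congr rfl fun j _ => hef j,
    Finset.sum_add_distrib, hswap]
  ring
end

section
/- Let R be a commutative ring, A a commutative R-algebra, x ∈ A, and B, C ∈ R such that x³ = B·x + C in A (scalars in R are identified with their images in A). Let ∫ : A → R be an R-linear map with ∫(1) = 0, ∫(x) = 0, and ∫(x²) = 1. Then for all integers a, b ≥ 0: ∫((3·x² + 2·B)^a·(3·x² − B)^b) = φ_{a,b}(B, C), where φ_{a,b}(B, C) denotes the evaluation at (B, C) of the integer polynomial φ_{a,b}. -/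
open MvPolynomial in
/-- The polynomials `φ_{a,b}(x,y) ∈ ℤ[x,y]`, defined by the recursions
`φ_{0,0} = 0`, `φ_{0,1} = 3`, `φ_{0,2} = 3x`,
`φ_{0,b+3} = 3x·φ_{0,b+2} + (27y² − 4x³)·φ_{0,b}`, and
`φ_{a+1,b} = φ_{a,b+1} + 3x·φ_{a,b}`. -/
noncomputable def phi : ℕ → ℕ → MvPolynomial (Fin 2) ℤ
  | 0, 0 => 0
  | 0, 1 => 3
  | 0, 2 => 3 * X 0
  | 0, b + 3 => 3 * X 0 * phi 0 (b + 2) + (27 * X 1 ^ 2 - 4 * X 0 ^ 3) * phi 0 b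
  | a + 1, b => phi a (b + 1) + 3 * X 0 * phi a b
  termination_by a b => (a, b)

/-- If `x³ = B·x + C`, then `∫((3x² + 2B)^a·(3x² − B)^b) = φ_{a,b}(B, C)`. -/
theorem stmt_10 (R A : Type*) [CommRing R] [CommRing A] [Algebra R A]
    (x : A) (B C : R)
    (hx : x ^ 3 = algebraMap R A B * x + algebraMap R A C)
    (int : A →ₗ[R] R)
    (h1 : int 1 = 0)
    (hx1 : int x = 0)
    (hx2 : int (x ^ 2) = 1) :
    ∀ a b : ℕ,
      int ((3 * x ^ 2 + algebraMap R A (2 * B)) ^ a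
        * (3 * x ^ 2 - algebraMap R A B) ^ b)
      = MvPolynomial.aeval ![B, C] (phi a b) := by
  have int_smul : ∀ (r : R) (y : A), int (algebraMap R A r * y) = r * int y := fun r y => by
    rw [← Algebra.smul_def, map_smul, smul_eq_mul]
  have h_cubic : (3 * x ^ 2 - algebraMap R A B) ^ 3
      = algebraMap R A (3 * B) * (3 * x ^ 2 - algebraMap R A B) ^ 2
        + algebraMap R A (27 * C ^ 2 - 4 * B ^ 3) := by
    simp only [map_mul, map_sub, map_pow, map_ofNat]
    linear_combination
      27 * (x ^ 3 - algebraMap R A B * x + algebraMap R A C) * hx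
  have h_zero : ∀ b : ℕ, int ((3 * x ^ 2 - algebraMap R A B) ^ b)
      = MvPolynomial.aeval ![B, C] (phi 0 b) := by
    intro b
    induction b using Nat.strong_induction_on with
    | _ b ih =>
      match b with
      | 0 => simp [phi, h1]
      | 1 =>
        have e : (3 * x ^ 2 - algebraMap R A B) ^ 1
            = algebraMap R A 3 * x ^ 2 - algebraMap R A B * 1 := by
          rw [map_ofNat]; ring
        rw [e, map_sub, int_smul, int_smul, h1, hx2]
        simp [phi]
      | 2 =>
        have e : (3 * x ^ 2 - algebraMap R A B) ^ 2
            = algebraMap R A (3 * B) * x ^ 2 + algebraMap R A (9 * C) * x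
              + algebraMap R A (B ^ 2) * 1 := by
          simp only [map_mul, map_pow, map_ofNat]
          linear_combination 9 * x * hx
        rw [e, map_add, map_add, int_smul, int_smul, int_smul, h1, hx1, hx2]
        simp [phi]
      | b + 3 =>
        have e : (3 * x ^ 2 - algebraMap R A B) ^ (b + 3)
            = algebraMap R A (3 * B) * (3 * x ^ 2 - algebraMap R A B) ^ (b + 2)
              + algebraMap R A (27 * C ^ 2 - 4 * B ^ 3)
                * (3 * x ^ 2 - algebraMap R A B) ^ b := by
          linear_combination (3 * x ^ 2 - algebraMap R A B) ^ b * h_cubic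
        rw [e, map_add, int_smul, int_smul, ih (b + 2) (by lia), ih b (by lia)]
        conv_rhs => rw [phi]
        simp
  intro a
  induction a with
  | zero => simpa using h_zero
  | succ a ih =>
    intro b
    have e : (3 * x ^ 2 + algebraMap R A (2 * B)) ^ (a + 1) * (3 * x ^ 2 - algebraMap R A B) ^ b
        = (3 * x ^ 2 + algebraMap R A (2 * B)) ^ a * (3 * x ^ 2 - algebraMap R A B) ^ (b + 1)
          + algebraMap R A (3 * B)
            * ((3 * x ^ 2 + algebraMap R A (2 * B)) ^ a * (3 * x ^ 2 - algebraMap R A B) ^ b) := by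
      simp only [map_mul, map_ofNat]
      ring
    rw [e, map_add, int_smul, ih, ih]
    conv_rhs => rw [phi]
    simp
end

section
/- For all integers a, b ≥ 0 with a + b ≥ 1, the polynomial φ_{a,b} is weighted homogeneous of degree 2(a+b−1) for the weights deg(x) = 2, deg(y) = 3; equivalently, in the polynomial ring ℤ[x,y,t] one has φ_{a,b}(t²·x, t³·y) = t^{2(a+b−1)}·φ_{a,b}(x, y). -/
/-- Weighted homogeneity of `phi`, multiplied by `t ^ 2` so that it also holds for `a = b = 0`. -/
theorem sq_mul_aeval_phi {R : Type*} [CommRing R] [Algebra ℤ R] (x y t : R) (a b : ℕ) :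
    t ^ 2 * MvPolynomial.aeval ![t ^ 2 * x, t ^ 3 * y] (phi a b) =
      t ^ (2 * (a + b)) * MvPolynomial.aeval ![x, y] (phi a b) := by
  induction a, b using phi.induct with
  | case1 => simp [phi]
  | case2 => simp [phi]
  | case3 =>
    simp only [phi, map_mul, map_ofNat, MvPolynomial.aeval_X,
      Matrix.cons_val_zero]
    ring
  | case4 b ih₁ ih₂ =>
    simp only [phi, Nat.succ_eq_add_one, map_add, map_sub, map_mul, map_pow, map_ofNat,
      MvPolynomial.aeval_X, Matrix.cons_val_zero, Matrix.cons_val_one]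
    linear_combination (3 * (t ^ 2 * x)) * ih₁ +
      (27 * (t ^ 3 * y) ^ 2 - 4 * (t ^ 2 * x) ^ 3) * ih₂
  | case5 a b ih₁ ih₂ =>
    simp only [phi, Nat.succ_eq_add_one, map_add, map_mul, map_ofNat, MvPolynomial.aeval_X,
      Matrix.cons_val_zero]
    linear_combination ih₁ + (3 * (t ^ 2 * x)) * ih₂

open MvPolynomial in
/-- `φ_{a,b}` is weighted homogeneous of degree `2(a+b−1)` for `deg x = 2`, `deg y = 3`:
in `ℤ[x,y,t]` one has `φ_{a,b}(t²x, t³y) = t^{2(a+b−1)}·φ_{a,b}(x,y)`. -/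
theorem stmt_13 :
    ∀ a b : ℕ, 1 ≤ a + b →
      MvPolynomial.aeval
          ![(X 2 : MvPolynomial (Fin 3) ℤ) ^ 2 * X 0, (X 2 : MvPolynomial (Fin 3) ℤ) ^ 3 * X 1]
          (phi a b)
        = (X 2 : MvPolynomial (Fin 3) ℤ) ^ (2 * (a + b - 1))
            * MvPolynomial.aeval ![(X 0 : MvPolynomial (Fin 3) ℤ), X 1] (phi a b) := by
  intro a b hab
  have ht : (X 2 : MvPolynomial (Fin 3) ℤ) ^ 2 ≠ 0 := pow_ne_zero 2 (X_ne_zero 2)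
  apply mul_left_cancel₀ ht
  rw [sq_mul_aeval_phi, ← mul_assoc, ← pow_add]
  congr 2
  omega
end

section
/- For every integer d ≥ 1, the ℚ-vector space of tuples (c_0, c_1, …, c_{⌊d/2⌋}) ∈ ℚ^{⌊d/2⌋+1} satisfying Σ_{j=0}^{⌊d/2⌋} c_j·φ_{d−2j, 2j}(x,y) = 0 in ℚ[x,y] has dimension at least ⌊d/2⌋ − ⌊(d−1)/3⌋. -/
open MvPolynomial in
/-- The span of the polynomials `x^(n-3k) * (27y² - 4x³)^k` with `3k ≤ n`, that is, of those
that are homogeneous of weight `n` when `x` has weight `1` and `27y² - 4x³` has weight `3`. -/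
noncomputable def weightSpan (n : ℕ) : Submodule ℚ (MvPolynomial (Fin 2) ℚ) :=
  Submodule.span ℚ (Set.range fun k : Fin (n / 3 + 1) =>
    X 0 ^ (n - 3 * (k : ℕ)) * (27 * X 1 ^ 2 - 4 * X 0 ^ 3) ^ (k : ℕ))

theorem finrank_weightSpan_le (n : ℕ) : Module.finrank ℚ (weightSpan n) ≤ n / 3 + 1 :=
  (finrank_range_le_card _).trans_eq (Fintype.card_fin _)

open MvPolynomial in
theorem pow_mul_pow_mem_weightSpan {n i k : ℕ} (h : i + 3 * k = n) :
    X 0 ^ i * (27 * X 1 ^ 2 - 4 * X 0 ^ 3) ^ k ∈ weightSpan n := by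
  refine Submodule.subset_span ⟨⟨k, by omega⟩, ?_⟩
  simp [← h]

open MvPolynomial in
theorem X_mul_mem_weightSpan {n : ℕ} {p : MvPolynomial (Fin 2) ℚ} (hp : p ∈ weightSpan n) :
    X 0 * p ∈ weightSpan (n + 1) := by
  refine (Submodule.span_le (p := (weightSpan (n + 1)).comap (LinearMap.mulLeft ℚ (X 0)))).2 ?_ hp
  rintro _ ⟨k, rfl⟩
  have hk := k.2
  simpa [pow_succ', mul_assoc] using pow_mul_pow_mem_weightSpan
    (show n - 3 * (k : ℕ) + 1 + 3 * k = n + 1 by omega)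

open MvPolynomial in
theorem discr_mul_mem_weightSpan {n : ℕ} {p : MvPolynomial (Fin 2) ℚ} (hp : p ∈ weightSpan n) :
    (27 * X 1 ^ 2 - 4 * X 0 ^ 3) * p ∈ weightSpan (n + 3) := by
  refine (Submodule.span_le (p := (weightSpan (n + 3)).comap
    (LinearMap.mulLeft ℚ (27 * X 1 ^ 2 - 4 * X 0 ^ 3)))).2 ?_ hp
  rintro _ ⟨k, rfl⟩
  have hk := k.2
  simpa [pow_succ', mul_left_comm] using pow_mul_pow_mem_weightSpan
    (show n - 3 * (k : ℕ) + 3 * (k + 1) = n + 3 by omega)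

theorem three_mul_mem_weightSpan {n : ℕ} {p : MvPolynomial (Fin 2) ℚ} (hp : p ∈ weightSpan n) :
    3 * p ∈ weightSpan n := by
  simpa [nsmul_eq_mul] using (weightSpan n).nsmul_mem hp 3

open MvPolynomial in
theorem map_phi_mem_weightSpan (a b n : ℕ) (h : a + b = n + 1) :
    map (Int.castRingHom ℚ) (phi a b) ∈ weightSpan n := by
  have one_mem : (1 : MvPolynomial (Fin 2) ℚ) ∈ weightSpan 0 := by
    simpa using pow_mul_pow_mem_weightSpan (show 0 + 3 * 0 = 0 from rfl)
  induction a, b using phi.induct generalizing n with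
  | case1 => omega
  | case2 =>
    obtain rfl : n = 0 := by omega
    simpa [phi] using three_mul_mem_weightSpan one_mem
  | case3 =>
    obtain rfl : n = 1 := by omega
    simpa [phi] using three_mul_mem_weightSpan (X_mul_mem_weightSpan one_mem)
  | case4 b ih₂ ih₀ =>
    obtain rfl : n = b + 2 := by omega
    have h₂ := three_mul_mem_weightSpan (X_mul_mem_weightSpan (ih₂ (b + 1) (by omega)))
    have h₀ : (27 * X 1 ^ 2 - 4 * X 0 ^ 3) * map (Int.castRingHom ℚ) (phi 0 b) ∈
        weightSpan (b + 2) := by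
      cases b with
      | zero => simp [phi]
      | succ m => exact discr_mul_mem_weightSpan (ih₀ m (by omega))
    rw [phi]
    simpa [mul_assoc] using add_mem h₂ h₀
  | case5 a b ih₁ ih₀ =>
    have h₁ := ih₁ n (by omega)
    have h₀ : 3 * (X 0 * map (Int.castRingHom ℚ) (phi a b)) ∈ weightSpan n := by
      cases n with
      | zero =>
        obtain ⟨rfl, rfl⟩ : a = 0 ∧ b = 0 := by omega
        simp [phi]
      | succ m => exact three_mul_mem_weightSpan (X_mul_mem_weightSpan (ih₀ m (by omega)))
    rw [phi]
    simpa [mul_assoc] using add_mem h₁ h₀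

/-- The space of tuples `(c_0,…,c_{⌊d/2⌋})` of rationals with
`Σ_j c_j·φ_{d−2j,2j}(x,y) = 0` in `ℚ[x,y]` has dimension at least
`⌊d/2⌋ − ⌊(d−1)/3⌋`. -/
theorem stmt_14 (d : ℕ) (hd : 1 ≤ d) :
    d / 2 - (d - 1) / 3 ≤ Module.finrank ℚ
      (LinearMap.ker (∑ j : Fin (d / 2 + 1),
        LinearMap.smulRight
          (LinearMap.proj j : ((Fin (d / 2 + 1) → ℚ) →ₗ[ℚ] ℚ))
          (MvPolynomial.map (Int.castRingHom ℚ)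
            (phi (d - 2 * (j : ℕ)) (2 * (j : ℕ)))))) := by
  set f := ∑ j : Fin (d / 2 + 1),
    LinearMap.smulRight
      (LinearMap.proj j : ((Fin (d / 2 + 1) → ℚ) →ₗ[ℚ] ℚ))
      (MvPolynomial.map (Int.castRingHom ℚ) (phi (d - 2 * (j : ℕ)) (2 * (j : ℕ)))) with hf
  have range_le : LinearMap.range f ≤ weightSpan (d - 1) := by
    rintro _ ⟨c, rfl⟩
    rw [hf, LinearMap.sum_apply]
    refine sum_mem fun j _ => Submodule.smul_mem _ _ (map_phi_mem_weightSpan _ _ _ ?_)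
    have hj := j.2
    omega
  have : Module.Finite ℚ (weightSpan (d - 1)) :=
    Module.Finite.span_of_finite ℚ (Set.finite_range _)
  have rank_le := (Submodule.finrank_mono range_le).trans (finrank_weightSpan_le (d - 1))
  have rank_nullity := f.finrank_range_add_finrank_ker
  rw [Module.finrank_fin_fun] at rank_nullity
  omega
end

section
/- Let n ≥ 2 and let S = {(i,j) ∈ Fin n × Fin n : i ≠ j}. Let P ∈ ℚ[D_{ij} : (i,j) ∈ S] be a polynomial that is homogeneous of degree 2 and that is fixed both by every ℚ-algebra automorphism θ_k (k ∈ Fin n) determined by θ_k(D_{ij}) = −D_{ij} if j = k and θ_k(D_{ij}) = D_{ij} if j ≠ k, and by every ℚ-algebra automorphism determined by a permutation σ of Fin n via D_{ij} ↦ D_{σ(i)σ(j)}. Then there exist α, β ∈ ℚ such that P = α·I₁ + β·I₂, where I₁ = Σ_{(i,j), i≠j} D_{ij}² and I₂ = Σ_{i,j,k pairwise distinct} D_{ik}·D_{jk}. -/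
open MvPolynomial in
/-- A quadratic form in finitely many variables is the double sum given by its Gram matrix. -/
theorem MvPolynomial.IsHomogeneous.eq_sum_sum_of_two {ι : Type*} [Fintype ι] [DecidableEq ι]
    {P : MvPolynomial ι ℚ} (hP : P.IsHomogeneous 2) :
    P = ∑ p, ∑ q, ((if p = q then 1 else 1 / 2 : ℚ) *
      P.coeff (Finsupp.single p 1 + Finsupp.single q 1)) • (X p * X q) := by
  ext m
  have hX (p q : ι) : (X p * X q : MvPolynomial ι ℚ) =
      monomial (Finsupp.single p 1 + Finsupp.single q 1) 1 := by
    simp [X, monomial_mul]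
  simp only [coeff_sum, coeff_smul, hX, coeff_monomial, smul_eq_mul]
  by_cases hm : m.degree = 2
  · obtain ⟨r, s, rfl⟩ : ∃ r s : ι, m = Finsupp.single r 1 + Finsupp.single s 1 := by
      have hc : m.toMultiset.card = 2 := by
        rw [Finsupp.card_toMultiset]
        exact hm
      obtain ⟨r, s, hrs⟩ := Multiset.card_eq_two.mp hc
      refine ⟨r, s, Multiset.toFinsupp.symm.injective ?_⟩
      change m.toMultiset = Finsupp.toMultiset _
      rw [hrs]
      simp [Finsupp.toMultiset_single]
    have key (p q : ι) : (Finsupp.single p 1 + Finsupp.single q 1 : ι →₀ ℕ) =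
        Finsupp.single r 1 + Finsupp.single s 1 ↔ (p = r ∧ q = s) ∨ (p = s ∧ q = r) := by
      rw [Finsupp.single_add_single_eq_single_add_single (by simp) (by simp)]
      simp
    simp only [key]
    by_cases hrs : r = s
    · subst hrs
      simp [ite_and]
    · have hsplit (p q : ι) (a : ℚ) :
          (a * if (p = r ∧ q = s) ∨ (p = s ∧ q = r) then 1 else 0) =
          (if p = r then if q = s then a else 0 else 0) +
            if p = s then if q = r then a else 0 else 0 := by
        grind
      simp only [hsplit, Finset.sum_add_distrib]
      simp [hrs, Ne.symm hrs, add_comm (Finsupp.single s 1)]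
      ring
  · rw [hP.coeff_eq_zero hm]
    symm
    refine Finset.sum_eq_zero fun p _ => Finset.sum_eq_zero fun q _ => ?_
    have hpq : Finsupp.single p 1 + Finsupp.single q 1 ≠ m := by
      rintro rfl
      simp at hm
    rw [if_neg hpq, mul_zero]

open MvPolynomial in
/-- Rescaling the variables multiplies each coefficient by the corresponding monomial. -/
theorem MvPolynomial.coeff_aeval_smul_X {ι R : Type*} [CommSemiring R] (ε : ι → R)
    (P : MvPolynomial ι R) (m : ι →₀ ℕ) :
    (aeval (fun p => ε p • (X p : MvPolynomial ι R)) P).coeff m =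
      (m.prod fun p k => ε p ^ k) * P.coeff m := by
  classical
  induction P using MvPolynomial.induction_on' with
  | monomial u a =>
    have : aeval (fun p => ε p • (X p : MvPolynomial ι R)) (monomial u a) =
        monomial u ((u.prod fun p k => ε p ^ k) * a) := by
      rw [aeval_monomial, monomial_eq, C_mul]
      simp only [smul_eq_C_mul, mul_pow, Finsupp.prod_mul, algebraMap_eq]
      simp only [Finsupp.prod, map_prod, map_pow]
      ring
    rw [this, coeff_monomial, coeff_monomial]
    split_ifs with h <;> simp [h]
  | add p q hp hq => rw [map_add, coeff_add, coeff_add, hp, hq, mul_add]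

/-- Any two injective families of the same finite length are related by a permutation. -/
theorem Equiv.Perm.exists_apply_eq_of_injective {α : Type*} {m : ℕ} {f g : Fin m → α}
    (hf : f.Injective) (hg : g.Injective) : ∃ σ : Equiv.Perm α, ∀ i, σ (f i) = g i := by
  obtain ⟨σ, hσ⟩ := (Equiv.Perm.isMultiplyPretransitive α m).exists_smul_eq ⟨f, hf⟩ ⟨g, hg⟩
  exact ⟨σ, fun i => DFunLike.congr_fun hσ i⟩

/-- A sum over pairs of distinct elements as an iterated sum. -/
theorem Fintype.sum_subtype_fst_ne_snd {α M : Type*} [Fintype α] [DecidableEq α]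
    [AddCommMonoid M] (f : {p : α × α // p.1 ≠ p.2} → M) :
    ∑ p, f p = ∑ i, ∑ k, if h : i ≠ k then f ⟨(i, k), h⟩ else 0 := by
  rw [← Fintype.sum_prod_type' (f := fun i k => if h : i ≠ k then f ⟨(i, k), h⟩ else 0)]
  symm
  refine Finset.sum_bij_ne_zero (fun p _ hp => ⟨p, fun h => hp (dif_neg (not_not.mpr h))⟩)
    (by simp) (by simp) ?_ ?_
  · rintro ⟨⟨i, k⟩, h⟩ _ hf
    exact ⟨(i, k), Finset.mem_univ _, by simpa [show i ≠ k from h] using hf, rfl⟩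
  · intro p _ hp
    split_ifs with h
    · rfl
    · exact (hp (dif_neg h)).elim

/-- The ordered pairs of distinct elements of a type. -/
abbrev OffDiagonalPair (α : Type*) : Type _ := {p : α × α // p.1 ≠ p.2}

/-- A degree-2 homogeneous polynomial in the variables `D_{ij}` (`i ≠ j`) invariant under all
sign changes `θ_k` and all permutations `σ` of the indices is a `ℚ`-linear combination of
`I₁ = Σ_{i≠j} D_{ij}²` and `I₂ = Σ_{i,j,k distinct} D_{ik}·D_{jk}`. -/
theorem stmt_18 (n : ℕ) (hn : 2 ≤ n)
    (P : MvPolynomial {p : Fin n × Fin n // p.1 ≠ p.2} ℚ)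
    (hP : P.IsHomogeneous 2)
    (htheta : ∀ k : Fin n,
      MvPolynomial.aeval (fun p : {p : Fin n × Fin n // p.1 ≠ p.2} =>
        if (p : Fin n × Fin n).2 = k then -MvPolynomial.X p else MvPolynomial.X p) P = P)
    (hperm : ∀ σ : Equiv.Perm (Fin n),
      MvPolynomial.aeval (fun p : {p : Fin n × Fin n // p.1 ≠ p.2} =>
        MvPolynomial.X (⟨(σ (p : Fin n × Fin n).1, σ (p : Fin n × Fin n).2),
          fun h => p.property (σ.injective h)⟩ :
            {p : Fin n × Fin n // p.1 ≠ p.2})) P = P) :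
    ∃ α β : ℚ,
      P = α • (∑ p : {p : Fin n × Fin n // p.1 ≠ p.2}, MvPolynomial.X p ^ 2)
        + β • (∑ i : Fin n, ∑ j : Fin n, ∑ k : Fin n,
            if h : i ≠ j ∧ i ≠ k ∧ j ≠ k then
              MvPolynomial.X (⟨(i, k), h.2.1⟩ : {p : Fin n × Fin n // p.1 ≠ p.2})
                * MvPolynomial.X (⟨(j, k), h.2.2⟩ : {p : Fin n × Fin n // p.1 ≠ p.2})
            else 0) := by
  classical
  set c : OffDiagonalPair (Fin n) → OffDiagonalPair (Fin n) → ℚ := fun p q =>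
    P.coeff (Finsupp.single p 1 + Finsupp.single q 1) with hc
  have hzero (p q : OffDiagonalPair (Fin n)) (h : p.1.2 ≠ q.1.2) : c p q = 0 := by
    let ε : OffDiagonalPair (Fin n) → ℚ := fun r => if r.1.2 = p.1.2 then -1 else 1
    have hfun : (fun r : OffDiagonalPair (Fin n) =>
        if r.1.2 = p.1.2 then -MvPolynomial.X r else MvPolynomial.X r) =
        fun r => ε r • (MvPolynomial.X r : MvPolynomial (OffDiagonalPair (Fin n)) ℚ) := by
      funext r
      by_cases hr : r.1.2 = p.1.2 <;> simp [ε, hr]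
    have h1 := MvPolynomial.coeff_aeval_smul_X ε P (Finsupp.single p 1 + Finsupp.single q 1)
    rw [← hfun, htheta p.1.2, Finsupp.prod_add_index' (by simp) (by simp [pow_add])] at h1
    simp [ε, Ne.symm h] at h1
    simp only [hc]
    linarith
  have hinv (σ : Equiv.Perm (Fin n)) (p q p' q' : OffDiagonalPair (Fin n))
      (hp : p'.1 = (σ p.1.1, σ p.1.2))
      (hq : q'.1 = (σ q.1.1, σ q.1.2)) : c p' q' = c p q := by
    let e : OffDiagonalPair (Fin n) → OffDiagonalPair (Fin n) := fun r =>
      ⟨(σ r.1.1, σ r.1.2), fun h => r.2 (σ.injective h)⟩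
    have he : e.Injective := by
      rintro ⟨⟨a, b⟩, _⟩ ⟨⟨a', b'⟩, _⟩ h
      have h' := congrArg Subtype.val h
      simpa [e] using h'
    have h1 := MvPolynomial.coeff_rename_mapDomain e he P
      (Finsupp.single p 1 + Finsupp.single q 1)
    have h2 : MvPolynomial.rename e P = P := by
      rw [MvPolynomial.rename_eq_aeval]
      exact hperm σ
    rw [h2, Finsupp.mapDomain_add, Finsupp.mapDomain_single, Finsupp.mapDomain_single] at h1
    have hp' : p' = e p := Subtype.ext hp
    have hq' : q' = e q := Subtype.ext hq
    simpa only [hc, hp', hq'] using h1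
  obtain ⟨α, hα⟩ : ∃ α, ∀ p, c p p = α := by
    by_cases h : Nonempty (OffDiagonalPair (Fin n))
    · have hinj (p : OffDiagonalPair (Fin n)) : Function.Injective ![p.1.1, p.1.2] := by
        intro a b
        fin_cases a <;> fin_cases b <;> simp [p.2, Ne.symm p.2]
      obtain ⟨p₀⟩ := h
      refine ⟨c p₀ p₀, fun p => ?_⟩
      obtain ⟨σ, hσ⟩ := Equiv.Perm.exists_apply_eq_of_injective
        (hinj p₀) (hinj p)
      have h0 := hσ 0
      have h1 := hσ 1
      simp at h0 h1
      exact hinv σ _ _ _ _ (by rw [h0, h1]) (by rw [h0, h1])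
    · exact ⟨0, fun p => (h ⟨p⟩).elim⟩
  obtain ⟨β, hβ⟩ : ∃ β, ∀ p q : OffDiagonalPair (Fin n), p ≠ q → p.1.2 = q.1.2 → c p q = β := by
    by_cases h : ∃ p q : OffDiagonalPair (Fin n), p ≠ q ∧ p.1.2 = q.1.2
    · have hinj (p q : OffDiagonalPair (Fin n)) (h : p ≠ q) (h' : p.1.2 = q.1.2) :
          Function.Injective ![p.1.1, q.1.1, p.1.2] := by
        have h1 := p.2
        have h2 := q.2
        have h3 : p.1.1 ≠ q.1.1 := fun h3 => h (Subtype.ext (Prod.ext h3 h'))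
        intro a b
        fin_cases a <;> fin_cases b <;> simp <;> grind
      obtain ⟨p₀, q₀, h₀, h₀'⟩ := h
      refine ⟨c p₀ q₀, fun p q h h' => ?_⟩
      obtain ⟨σ, hσ⟩ := Equiv.Perm.exists_apply_eq_of_injective (hinj p₀ q₀ h₀ h₀') (hinj p q h h')
      have h0 := hσ 0
      have h1 := hσ 1
      have h2 := hσ 2
      simp at h0 h1 h2
      exact hinv σ _ _ _ _ (by rw [h0, h2]) (by rw [h1, ← h₀', h2, h'])
    · exact ⟨0, fun p q hpq hpq' => (h ⟨p, q, hpq, hpq'⟩).elim⟩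
  refine ⟨α, β / 2, ?_⟩
  have hterm (p q : OffDiagonalPair (Fin n)) : ((if p = q then 1 else 1 / 2 : ℚ) * c p q) •
      (MvPolynomial.X p * MvPolynomial.X q : MvPolynomial (OffDiagonalPair (Fin n)) ℚ) =
      α • (if p = q then MvPolynomial.X p ^ 2 else 0) +
      (β / 2) • (if p ≠ q ∧ p.1.2 = q.1.2 then MvPolynomial.X p * MvPolynomial.X q else 0) := by
    by_cases hpq : p = q
    · subst hpq
      simp [hα, sq]
    · by_cases hpq' : p.1.2 = q.1.2
      · simp only [if_neg hpq, hβ p q hpq hpq', if_pos (And.intro hpq hpq'), smul_zero, zero_add,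
          ne_eq]
        congr 1
        ring
      · simp [hpq, hpq', hzero p q hpq']
  rw [hP.eq_sum_sum_of_two]
  change ∑ p : OffDiagonalPair (Fin n), ∑ q : OffDiagonalPair (Fin n),
      ((if p = q then 1 else 1 / 2 : ℚ) * c p q) •
      (MvPolynomial.X p * MvPolynomial.X q : MvPolynomial (OffDiagonalPair (Fin n)) ℚ) = _
  simp only [hterm, Finset.sum_add_distrib, ← Finset.smul_sum]
  congr 2
  · simp
  · rw [Fintype.sum_subtype_fst_ne_snd]
    refine Finset.sum_congr rfl fun i _ => ?_
    rw [Finset.sum_comm]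
    refine Finset.sum_congr rfl fun k _ => ?_
    split_ifs with hik
    · rw [Fintype.sum_subtype_fst_ne_snd]
      refine Finset.sum_congr rfl fun j _ => ?_
      rw [Finset.sum_eq_single k]
      · grind
      · grind
      · simp
    · symm
      exact Finset.sum_eq_zero fun j _ => by simp [hik]
end
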